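/- Let p ≥ 1, 1 ≤ r < p, and let (I, J, K) ∈ T^p_r. Define I₂ = J₂ = {2i − 1 : i ∈ I} ∪ {2j : j ∈ J} and K₂ = {2k − 1 : k ∈ K} ∪ {2k : k ∈ K}. Then (I₂, J₂, K₂) ∈ T^{2p}_{2r}. -/

import Mathlib

/-- The `f`-th smallest element (1-indexed) of a finite set of natural numbers. -/
def nthElt (I : Finset ℕ) (f : ℕ) : ℕ :=
  (I.sort (· ≤ ·)).getD (f - 1) 0

/-- `(I, J, K) ∈ U^n_r`: `I`, `J`, `K` are `r`-element subsets of `{1, …, n}` with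
`∑_{i∈I} i + ∑_{j∈J} j = ∑_{k∈K} k + r(r+1)/2`. -/
def IsU (n r : ℕ) (I J K : Finset ℕ) : Prop :=
  I ⊆ Finset.Icc 1 n ∧ J ⊆ Finset.Icc 1 n ∧ K ⊆ Finset.Icc 1 n ∧
  I.card = r ∧ J.card = r ∧ K.card = r ∧
  ∑ i ∈ I, i + ∑ j ∈ J, j = ∑ k ∈ K, k + r * (r + 1) / 2

/-- `(I, J, K) ∈ T^n_r`, defined recursively: `T^n_1 = U^n_1` and, for `r > 1`,
`(I, J, K) ∈ T^n_r` iff `(I, J, K) ∈ U^n_r` and for all `1 ≤ s < r` and all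
`(F, G, H) ∈ T^r_s` one has
`∑_{f∈F} i_f + ∑_{g∈G} j_g ≤ ∑_{h∈H} k_h + s(s+1)/2`,
where `i_f` denotes the `f`-th smallest element of `I`, etc. -/
def IsT (n r : ℕ) (I J K : Finset ℕ) : Prop :=
  IsU n r I J K ∧
  ∀ s, 1 ≤ s → s < r → ∀ F G H : Finset ℕ, IsT r s F G H →
    ∑ f ∈ F, nthElt I f + ∑ g ∈ G, nthElt J g ≤ ∑ h ∈ H, nthElt K h + s * (s + 1) / 2
termination_by r

namespace HornDoubling

open Set Filter Topology Module
open scoped ContDiff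

section Thin

variable {E F : Type*} [NormedAddCommGroup E] [NormedSpace ℝ E]
  [NormedAddCommGroup F] [NormedSpace ℝ F]

/-- A subset of a real normed space is thin if it lies in the zero set of a nonzero analytic
function. -/
def Thin (D : Set E) : Prop :=
  ∃ h : E → ℝ, ContDiff ℝ ω h ∧ (∃ x, h x ≠ 0) ∧ ∀ x ∈ D, h x = 0

lemma eq_zero_of_eqOn_open {h : E → ℝ} (hh : ContDiff ℝ ω h) {X : Set E} (hX : IsOpen X)
    (hne : X.Nonempty) (h0 : ∀ x ∈ X, h x = 0) (x : E) : h x = 0 := by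
  obtain ⟨y, hy⟩ := hne
  rw [contDiff_omega_iff_analyticOnNhd] at hh
  have := hh.eq_of_eventuallyEq (g := 0) analyticOnNhd_const (z₀ := y)
    (by filter_upwards [hX.mem_nhds hy] with z hz using h0 z hz)
  exact congrFun this x

lemma exists_mul_ne_zero {h g : E → ℝ} (hh : ContDiff ℝ ω h) (hg : ContDiff ℝ ω g)
    (hh0 : ∃ x, h x ≠ 0) (hg0 : ∃ x, g x ≠ 0) : ∃ x, h x * g x ≠ 0 := by
  by_contra! hc
  obtain ⟨x, hx⟩ := hh0
  obtain ⟨y, hy⟩ := hg0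
  refine hy (eq_zero_of_eqOn_open hg (X := {x | h x ≠ 0}) ?_ ⟨x, hx⟩ ?_ y)
  · exact isOpen_ne_fun hh.continuous continuous_const
  · intro z hz
    exact (mul_eq_zero.1 (hc z)).resolve_left hz

lemma Thin.mono {D D' : Set E} (h : Thin D') (hD : D ⊆ D') : Thin D := by
  obtain ⟨h, h1, h2, h3⟩ := h
  exact ⟨h, h1, h2, fun x hx => h3 x (hD hx)⟩

lemma Thin.union {D D' : Set E} (h : Thin D) (h' : Thin D') : Thin (D ∪ D') := by
  obtain ⟨h, h1, h2, h3⟩ := h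
  obtain ⟨g, g1, g2, g3⟩ := h'
  refine ⟨fun x => h x * g x, h1.mul g1, exists_mul_ne_zero h1 g1 h2 g2, ?_⟩
  rintro x (hx | hx)
  · simp [h3 x hx]
  · simp [g3 x hx]

lemma thin_empty : Thin (∅ : Set E) :=
  ⟨fun _ => 1, contDiff_const, ⟨0, one_ne_zero⟩, by simp⟩

lemma Thin.iUnion {ι : Type*} [Finite ι] {D : ι → Set E} (h : ∀ i, Thin (D i)) :
    Thin (⋃ i, D i) := by
  classical
  have := Fintype.ofFinite ι
  suffices ∀ s : Finset ι, Thin (⋃ i ∈ s, D i) by simpa using this Finset.univ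
  intro s
  induction s using Finset.induction_on with
  | empty => simpa using thin_empty
  | insert a s _ ih =>
    rw [Finset.set_biUnion_insert]
    exact (h a).union ih

lemma not_thin_of_open {D X : Set E} (hX : IsOpen X) (hne : X.Nonempty) (hD : X ⊆ D) :
    ¬ Thin D := by
  rintro ⟨h, h1, ⟨x, hx⟩, h3⟩
  exact hx (eq_zero_of_eqOn_open h1 hX hne (fun y hy => h3 y (hD hy)) x)

lemma Thin.preimage {D : Set E} (h : Thin D) {f : F → E} (hf : ContDiff ℝ ω f)
    (hs : Function.Surjective f) : Thin (f ⁻¹' D) := by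
  obtain ⟨h, h1, ⟨x, hx⟩, h3⟩ := h
  obtain ⟨y, rfl⟩ := hs x
  exact ⟨h ∘ f, h1.comp hf, ⟨y, hx⟩, fun z hz => h3 _ hz⟩

/-- A nonempty open set contains a point which lies in no thin member of a finite family. -/
lemma exists_generic {ι : Type*} [Finite ι] (D : ι → Set E) {X : Set E} (hX : ¬ Thin X) :
    ∃ x ∈ X, ∀ i, x ∈ D i → ¬ Thin (D i) := by
  classical
  by_contra! hc
  refine hX ((Thin.iUnion (D := fun i => if Thin (D i) then D i else ∅) ?_).mono ?_)
  · intro i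
    split_ifs with h
    · exact h
    · exact thin_empty
  · intro x hx
    obtain ⟨i, hi, ht⟩ := hc x hx
    exact mem_iUnion.2 ⟨i, by rw [if_pos ht]; exact hi⟩

lemma contDiff_matrix_det {m : Type*} [Fintype m] [DecidableEq m] {M : E → m → m → ℝ}
    (hM : ContDiff ℝ ω M) : ContDiff ℝ ω fun x => (Matrix.of (M x)).det := by
  simp only [Matrix.det_apply', Matrix.of_apply]
  refine ContDiff.sum fun σ _ => ?_
  refine contDiff_const.mul ?_
  exact contDiff_prod fun i _ => by fun_prop

/-- If `L x` depends analytically on `x` and hits all of `κ → ℝ` for some `x`, then it does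
so for all `x` outside of a thin set. -/
lemma thin_not_surjective {A : Type*} [AddCommGroup A] [Module ℝ A] {κ : Type*} [Fintype κ]
    (L : E → A →ₗ[ℝ] (κ → ℝ)) (hL : ∀ φ, ContDiff ℝ ω fun x => L x φ) (x₀ : E)
    (h0 : Function.Surjective (L x₀)) : Thin {x | ¬ Function.Surjective (L x)} := by
  classical
  choose C hC using fun t : κ => h0 (Pi.single t 1)
  refine ⟨fun x => (Matrix.of fun t => L x (C t)).det, contDiff_matrix_det ?_, ⟨x₀, ?_⟩, ?_⟩
  · rw [contDiff_pi]
    exact fun t => hL _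
  · have : (Matrix.of fun t => L x₀ (C t)) = 1 := by
      ext t t'
      simp [hC, Matrix.one_apply, Pi.single_apply, eq_comm]
    simp only [this]; simp
  · intro x hx
    by_contra hd
    apply hx
    have hu : IsUnit (Matrix.of fun t => L x (C t)) :=
      (Matrix.isUnit_iff_isUnit_det _).2 (isUnit_iff_ne_zero.2 hd)
    have hli := Matrix.linearIndependent_rows_iff_isUnit.2 hu
    have hsp := hli.span_eq_top_of_card_eq_finrank' (by simp)
    rw [← LinearMap.range_eq_top, eq_top_iff, ← hsp, Submodule.span_le]
    rintro _ ⟨t, rfl⟩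
    exact ⟨C t, rfl⟩

end Thin

section Echelon

variable {V : Type*} [AddCommGroup V] [Module ℝ V] {n s : ℕ}

/-- `x` is a reduced echelon family with respect to `v`, with pivots at the positions `p`. -/
def Echelon (v : Fin n → V) (p : Fin s ↪o Fin n) (x : Fin s → V) : Prop :=
  ∀ a, v (p a) - x a ∈ Submodule.span ℝ (v '' {b | b ∉ range p ∧ p a < b})

lemma Echelon.exists_basis {v : Basis (Fin n) ℝ V} {p : Fin s ↪o Fin n} {x : Fin s → V}
    (h : Echelon v p x) :
    ∃ B : Basis (Fin n) ℝ V, (∀ a, B (p a) = x a) ∧ ∀ b, b ∉ range p → B b = v b := by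
  have hf : Module.Finite ℝ V := Module.Finite.of_basis v
  have hr : finrank ℝ V = Fintype.card (Fin n) := by
    rw [finrank_eq_card_basis v]
  have h1 : ∀ a, Function.extend p x v (p a) = x a := p.injective.extend_apply x v
  have h2 : ∀ b, b ∉ range p → Function.extend p x v b = v b := fun b hb =>
    Function.extend_apply' _ _ _ (by simpa using hb)
  have hsp : ⊤ ≤ Submodule.span ℝ (range (Function.extend p x v)) := by
    rw [← v.span_eq, Submodule.span_le]
    have hc : ∀ b, b ∉ range p → v b ∈ Submodule.span ℝ (range (Function.extend p x v)) := by
      intro b hb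
      rw [← h2 b hb]
      exact Submodule.subset_span ⟨b, rfl⟩
    rintro _ ⟨b, rfl⟩
    by_cases hb : b ∈ range p
    · obtain ⟨a, rfl⟩ := hb
      have := add_mem (Submodule.span_le.2 ?_ (h a))
        (Submodule.subset_span ⟨p a, h1 a⟩ :
          x a ∈ Submodule.span ℝ (range (Function.extend p x v)))
      · simpa using this
      · rintro _ ⟨c, hc', rfl⟩
        exact hc c hc'.1
    · exact hc b hb
  refine ⟨basisOfTopLeSpanOfCardEqFinrank _ hsp hr.symm, fun a => ?_, fun b hb => ?_⟩
  · rw [coe_basisOfTopLeSpanOfCardEqFinrank, h1]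
  · rw [coe_basisOfTopLeSpanOfCardEqFinrank, h2 b hb]

lemma Echelon.linearIndependent {v : Basis (Fin n) ℝ V} {p : Fin s ↪o Fin n} {x : Fin s → V}
    (h : Echelon v p x) : LinearIndependent ℝ x := by
  obtain ⟨B, hB, -⟩ := h.exists_basis
  have := B.linearIndependent.comp p p.injective
  convert this using 1
  ext a
  simp [hB]

lemma Echelon.repr_apply {v : Basis (Fin n) ℝ V} {p : Fin s ↪o Fin n} {x : Fin s → V}
    (h : Echelon v p x) (a a' : Fin s) : v.repr (x a) (p a') = if a = a' then 1 else 0 := by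
  have h1 := v.mem_span_image.1 (h a)
  have h2 : v.repr (v (p a) - x a) (p a') = 0 := by
    by_contra hc
    exact (h1 (Finsupp.mem_support_iff.2 hc)).1 ⟨a', rfl⟩
  rw [map_sub, Finsupp.sub_apply, sub_eq_zero, v.repr_self, Finsupp.single_apply] at h2
  simp [← h2]

lemma Echelon.sub_mem_span {v : Fin n → V} {p : Fin s ↪o Fin n} {x : Fin s → V}
    (h : Echelon v p x) {U : Set (Fin n)} (hU : IsUpperSet U) {a : Fin s} (ha : p a ∈ U) :
    x a ∈ Submodule.span ℝ (v '' U) := by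
  have h1 : v (p a) - x a ∈ Submodule.span ℝ (v '' U) :=
    Submodule.span_mono (image_mono fun b hb => hU hb.2.le ha) (h a)
  have h2 : v (p a) ∈ Submodule.span ℝ (v '' U) := Submodule.subset_span ⟨_, ha, rfl⟩
  simpa using sub_mem h2 h1

lemma Echelon.inf_span {v : Basis (Fin n) ℝ V} {p : Fin s ↪o Fin n} {x : Fin s → V}
    (h : Echelon v p x) {U : Set (Fin n)} (hU : IsUpperSet U) :
    Submodule.span ℝ (range x) ⊓ Submodule.span ℝ (v '' U) =
      Submodule.span ℝ (x '' {a | p a ∈ U}) := by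
  apply le_antisymm
  · rintro y ⟨hy, hyU⟩
    obtain ⟨c, rfl⟩ := (Submodule.mem_span_range_iff_exists_fun ℝ).1 hy
    refine Submodule.sum_mem _ fun a _ => ?_
    by_cases ha : p a ∈ U
    · exact Submodule.smul_mem _ _ (Submodule.subset_span ⟨a, ha, rfl⟩)
    · have h0 : v.repr (∑ i, c i • x i) (p a) = 0 := by
        by_contra hc
        exact ha (v.mem_span_image.1 hyU (Finsupp.mem_support_iff.2 hc))
      simp [h.repr_apply] at h0
      simp [h0]
  · rw [Submodule.span_le]
    rintro _ ⟨a, ha, rfl⟩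
    exact ⟨Submodule.subset_span ⟨a, rfl⟩, h.sub_mem_span hU ha⟩

lemma Echelon.finrank_inf_span {v : Basis (Fin n) ℝ V} {p : Fin s ↪o Fin n} {x : Fin s → V}
    (h : Echelon v p x) {U : Set (Fin n)} (hU : IsUpperSet U) [DecidablePred (p · ∈ U)] :
    finrank ℝ ↥(Submodule.span ℝ (range x) ⊓ Submodule.span ℝ (v '' U)) =
      (Finset.univ.filter fun a => p a ∈ U).card := by
  rw [h.inf_span hU]
  have h1 := h.linearIndependent.comp (Subtype.val : {a // p a ∈ U} → Fin s)
    Subtype.val_injective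
  have h2 := finrank_span_eq_card h1
  rw [range_comp, Subtype.range_coe_subtype] at h2
  rw [h2, Fintype.card_subtype]

lemma exists_echelon (v : Basis (Fin n) ℝ V) (S : Submodule ℝ V) (hs : finrank ℝ S = s) :
    ∃ (p : Fin s ↪o Fin n) (x : Fin s → V), Submodule.span ℝ (range x) = S ∧
      Echelon v p x := by
  classical
  have hf : Module.Finite ℝ V := Module.Finite.of_basis v
  set P : Finset (Fin n) :=
    Finset.univ.filter fun b => v b ∈ S ⊔ Submodule.span ℝ (v '' Ioi b) with hP
  have hmem : ∀ b, b ∈ P ↔ v b ∈ S ⊔ Submodule.span ℝ (v '' Ioi b) := by simp [hP]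
  have key : ∀ b, v b ∈ S ⊔ Submodule.span ℝ (v '' {c | c ∉ P ∧ b ≤ c}) := by
    intro b
    induction b using WellFoundedGT.induction with
    | ind b ih =>
      by_cases hb : b ∈ P
      · have h1 := (hmem b).1 hb
        refine (sup_le le_sup_left ?_ : S ⊔ Submodule.span ℝ (v '' Ioi b) ≤ _) h1
        rw [Submodule.span_le]
        rintro _ ⟨c, hc, rfl⟩
        have hle : Submodule.span ℝ (v '' {d | d ∉ P ∧ c ≤ d}) ≤
            Submodule.span ℝ (v '' {d | d ∉ P ∧ b ≤ d}) :=
          Submodule.span_mono (image_mono fun d hd => ⟨hd.1, (le_of_lt hc).trans hd.2⟩)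
        exact sup_le_sup le_rfl hle (ih c hc)
      · exact Submodule.mem_sup_right (Submodule.subset_span ⟨b, ⟨hb, le_rfl⟩, rfl⟩)
  have hdisj : Disjoint S (Submodule.span ℝ (v '' {c | c ∉ P})) := by
    rw [Submodule.disjoint_def]
    intro x hxS hx
    by_contra hx0
    have hsup := v.mem_span_image.1 hx
    have hne : (v.repr x).support.Nonempty := by
      rw [Finset.nonempty_iff_ne_empty, Ne, Finsupp.support_eq_empty]
      simpa using hx0
    set b := (v.repr x).support.min' hne with hb
    have hbm : b ∈ (v.repr x).support := Finset.min'_mem _ _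
    have hbP : b ∉ P := hsup hbm
    apply hbP
    rw [hmem]
    have hb0 : v.repr x b ≠ 0 := Finsupp.mem_support_iff.1 hbm
    have h1 : x - v.repr x b • v b ∈ Submodule.span ℝ (v '' Ioi b) := by
      rw [v.mem_span_image]
      intro c hc
      rw [Finset.mem_coe, Finsupp.mem_support_iff] at hc
      simp only [map_sub, map_smul, Basis.repr_self, Finsupp.sub_apply, Finsupp.smul_apply,
        Finsupp.single_apply, smul_eq_mul] at hc
      have hcb : c ≠ b := by
        rintro rfl
        simp at hc
      rw [if_neg (Ne.symm hcb)] at hc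
      have : c ∈ (v.repr x).support := by simpa using hc
      exact lt_of_le_of_ne (Finset.min'_le _ _ this) (Ne.symm hcb)
    have h2 : v.repr x b • v b ∈ S ⊔ Submodule.span ℝ (v '' Ioi b) := by
      have := sub_mem (Submodule.mem_sup_left hxS) (Submodule.mem_sup_right (S := S) h1)
      simpa using this
    have h3 := Submodule.smul_mem _ (v.repr x b)⁻¹ h2
    rwa [smul_smul, inv_mul_cancel₀ hb0, one_smul] at h3
  have htop : S ⊔ Submodule.span ℝ (v '' {c | c ∉ P}) = ⊤ := by
    rw [eq_top_iff, ← v.span_eq, Submodule.span_le]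
    rintro _ ⟨b, rfl⟩
    have hle : Submodule.span ℝ (v '' {d | d ∉ P ∧ b ≤ d}) ≤
        Submodule.span ℝ (v '' {d | d ∉ P}) := Submodule.span_mono (image_mono fun c hc => hc.1)
    exact sup_le_sup le_rfl hle (key b)
  have hcard : P.card = s := by
    have h1 := Submodule.finrank_add_eq_of_isCompl (K := ℝ) (V := V)
      ⟨hdisj, codisjoint_iff.2 htop⟩
    have h2 := finrank_span_eq_card
      (v.linearIndependent.comp (Subtype.val : {c // c ∉ P} → Fin n) Subtype.val_injective)
    rw [range_comp, Subtype.range_coe_subtype] at h2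
    rw [h2, hs, finrank_eq_card_basis v, Fintype.card_fin] at h1
    have h3 := Fintype.card_subtype_compl (fun c => c ∈ P)
    simp only [Fintype.card_fin, Fintype.card_coe] at h3
    have h4 : P.card ≤ n := by simpa using P.card_le_univ
    rw [h3] at h1
    omega
  set p := P.orderEmbOfFin hcard with hp
  have hrange : ∀ b, b ∈ range p ↔ b ∈ P := by
    intro b
    rw [hp, Finset.range_orderEmbOfFin]; rfl
  have hx : ∀ a, ∃ x ∈ S, v (p a) - x ∈
      Submodule.span ℝ (v '' {b | b ∉ range p ∧ p a < b}) := by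
    intro a
    obtain ⟨x, hx, z, hz, hxz⟩ := Submodule.mem_sup.1 (key (p a))
    refine ⟨x, hx, ?_⟩
    rw [← hxz, add_sub_cancel_left]
    refine Submodule.span_mono (image_mono ?_) hz
    rintro c ⟨hc, hac⟩
    refine ⟨by rwa [hrange], lt_of_le_of_ne hac ?_⟩
    rintro rfl
    exact hc ((hrange _).1 ⟨a, rfl⟩)
  choose x hxS hx using hx
  refine ⟨p, x, ?_, hx⟩
  have hE : Echelon v p x := hx
  apply Submodule.eq_of_le_of_finrank_eq
  · rw [Submodule.span_le]
    rintro _ ⟨a, rfl⟩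
    exact hxS a
  · rw [finrank_span_eq_card hE.linearIndependent, hs, Fintype.card_fin]

end Echelon

section Extremal

variable {V : Type*} [AddCommGroup V] [Module ℝ V] {r : ℕ}

/-- The subspace of `V` spanned by the kernel of `φ : S → V ⧸ S`. -/
def kerIn {S : Submodule ℝ V} (φ : S →ₗ[ℝ] V ⧸ S) : Submodule ℝ V :=
  (LinearMap.ker φ).map S.subtype

/-- The preimage in `V` of the range of `φ : S → V ⧸ S`. -/
def rangeOver {S : Submodule ℝ V} (φ : S →ₗ[ℝ] V ⧸ S) : Submodule ℝ V :=
  (LinearMap.range φ).comap S.mkQ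

lemma finrank_domRestrict [Module.Finite ℝ V] {V' : Type*} [AddCommGroup V'] [Module ℝ V']
    (f : V →ₗ[ℝ] V')
    (A : Submodule ℝ V) :
    finrank ℝ (A.map f) + finrank ℝ ↥(LinearMap.ker f ⊓ A) = finrank ℝ A := by
  have h := LinearMap.finrank_range_add_finrank_ker (f.domRestrict A)
  rw [LinearMap.range_domRestrict] at h
  rw [← h]
  congr 1
  rw [LinearMap.ker_domRestrict]
  have h2 : ((LinearMap.ker f).comap A.subtype).map A.subtype = LinearMap.ker f ⊓ A := by
    rw [Submodule.map_comap_subtype, inf_comm]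
  rw [← h2]
  exact Submodule.finrank_map_subtype_eq _ _

lemma finrank_map_inf {S : Submodule ℝ V} (T : Submodule ℝ S) (A : Submodule ℝ V) :
    finrank ℝ ↥(T.map S.subtype ⊓ A) = finrank ℝ ↥(T ⊓ A.comap S.subtype) := by
  have : T.map S.subtype ⊓ A = (T ⊓ A.comap S.subtype).map S.subtype := by
    ext x
    simp only [Submodule.mem_inf, Submodule.mem_map, Submodule.mem_comap]
    constructor
    · rintro ⟨⟨y, hy, rfl⟩, hA⟩
      exact ⟨y, ⟨hy, hA⟩, rfl⟩
    · rintro ⟨y, ⟨hy, hA⟩, rfl⟩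
      exact ⟨⟨y, hy, rfl⟩, hA⟩
  rw [this]
  exact Submodule.finrank_map_subtype_eq _ _

lemma finrank_inf_add_le [Module.Finite ℝ V] {S : Submodule ℝ V} (φ : S →ₗ[ℝ] V ⧸ S)
    (A B : Submodule ℝ V)
    (h : ∀ x : S, (x : V) ∈ A → φ x ∈ B.map S.mkQ) :
    finrank ℝ ↥(S ⊓ A) + finrank ℝ ↥(S ⊓ B) ≤
      finrank ℝ ↥(kerIn φ ⊓ A) + finrank ℝ ↥(rangeOver φ ⊓ B) := by
  have h1 := finrank_domRestrict φ (A.comap S.subtype)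
  have h2 := finrank_domRestrict S.mkQ (rangeOver φ ⊓ B)
  have h3 : (A.comap S.subtype).map φ ≤ (rangeOver φ ⊓ B).map S.mkQ := by
    rintro _ ⟨x, hx, rfl⟩
    obtain ⟨b, hb, hbx⟩ := h x hx
    exact ⟨b, ⟨⟨x, hbx.symm⟩, hb⟩, hbx⟩
  have h4 := Submodule.finrank_mono h3
  have h5 : finrank ℝ ↥(S ⊓ A) = finrank ℝ ↥(A.comap S.subtype) := by
    have := finrank_map_inf (⊤ : Submodule ℝ S) A
    rwa [Submodule.map_top, Submodule.range_subtype, top_inf_eq] at this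
  have h6 : finrank ℝ ↥(kerIn φ ⊓ A) = finrank ℝ ↥(LinearMap.ker φ ⊓ A.comap S.subtype) :=
    finrank_map_inf _ _
  have h7 : LinearMap.ker S.mkQ ⊓ (rangeOver φ ⊓ B) = S ⊓ B := by
    rw [Submodule.ker_mkQ, ← inf_assoc]
    congr 1
    rw [inf_eq_left]
    intro x hx
    rw [rangeOver, Submodule.mem_comap, Submodule.mkQ_apply,
      (Submodule.Quotient.mk_eq_zero S).2 hx]
    exact zero_mem _
  rw [h7] at h2
  omega

lemma finrank_kerIn_add [Module.Finite ℝ V] {S : Submodule ℝ V} (φ : S →ₗ[ℝ] V ⧸ S) :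
    finrank ℝ (kerIn φ) + finrank ℝ (rangeOver φ) = 2 * finrank ℝ S := by
  have h1 := LinearMap.finrank_range_add_finrank_ker φ
  have h2 : finrank ℝ (kerIn φ) = finrank ℝ (LinearMap.ker φ) :=
    Submodule.finrank_map_subtype_eq _ _
  have h3 := finrank_domRestrict S.mkQ (rangeOver φ)
  have h4 : (rangeOver φ).map S.mkQ = LinearMap.range φ := by
    rw [rangeOver, Submodule.map_comap_eq_of_surjective S.mkQ_surjective]
  have h5 : LinearMap.ker S.mkQ ⊓ rangeOver φ = S := by
    rw [Submodule.ker_mkQ, inf_eq_left]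
    intro x hx
    rw [rangeOver, Submodule.mem_comap, Submodule.mkQ_apply,
      (Submodule.Quotient.mk_eq_zero S).2 hx]
    exact zero_mem _
  rw [h4, h5] at h3
  omega

/-- The filtration of `V` given by a basis with keys `κ`. -/
def keySpan (v : Basis (Fin r) ℝ V) (κ : Fin r → ℕ) (t : ℕ) : Submodule ℝ V :=
  Submodule.span ℝ (v '' {b | t ≤ κ b})

/-- Total weight of a subspace for weights `ϖ (κ b)`, written in terms of dimensions. -/
noncomputable def layerWeight (v : Basis (Fin r) ℝ V) (κ : Fin r → ℕ) (ϖ : ℕ → ℕ) (T : ℕ)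
    (S : Submodule ℝ V) : ℤ :=
  ϖ 0 * finrank ℝ S +
    ∑ t ∈ Finset.range T, ((ϖ (t + 1) : ℤ) - ϖ t) * finrank ℝ ↥(S ⊓ keySpan v κ (t + 1))

lemma Echelon.layerWeight_eq {s : ℕ} {v : Basis (Fin r) ℝ V} {p : Fin s ↪o Fin r}
    {x : Fin s → V} (h : Echelon v p x) {κ : Fin r → ℕ} (hκ : StrictMono κ) (ϖ : ℕ → ℕ)
    {T : ℕ} (hT : ∀ b, κ b ≤ T) :
    layerWeight v κ ϖ T (Submodule.span ℝ (range x)) = ∑ a, (ϖ (κ (p a)) : ℤ) := by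
  classical
  have hk : ∀ k ≤ T, (ϖ k : ℤ) = ϖ 0 + ∑ t ∈ Finset.range T,
      ((ϖ (t + 1) : ℤ) - ϖ t) * (if t + 1 ≤ k then 1 else 0) := by
    intro k hk
    have h1 : ∑ t ∈ Finset.range T, ((ϖ (t + 1) : ℤ) - ϖ t) * (if t + 1 ≤ k then 1 else 0) =
        ∑ t ∈ Finset.range k, ((ϖ (t + 1) : ℤ) - ϖ t) := by
      simp only [mul_ite, mul_one, mul_zero]
      rw [← Finset.sum_filter]
      congr 1
      ext t
      simp only [Finset.mem_filter, Finset.mem_range]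
      omega
    rw [h1, Finset.sum_range_sub (fun t => (ϖ t : ℤ))]
    ring
  have hd : ∀ t, (finrank ℝ ↥(Submodule.span ℝ (range x) ⊓ keySpan v κ (t + 1)) : ℤ) =
      ∑ a, (if t + 1 ≤ κ (p a) then 1 else 0) := by
    intro t
    have hU : IsUpperSet {b | t + 1 ≤ κ b} := fun a b hab ha =>
      le_trans ha (hκ.monotone hab)
    rw [keySpan, h.finrank_inf_span hU]
    simp
  rw [layerWeight, finrank_span_eq_card h.linearIndependent]
  simp only [hd, Fintype.card_fin]
  rw [Finset.sum_congr rfl fun a _ => hk _ (hT (p a)), Finset.sum_add_distrib,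
    Finset.sum_comm]
  simp only [Finset.mul_sum]
  simp [mul_comm]

lemma layerWeight_add_le [Module.Finite ℝ V] {S : Submodule ℝ V} (φ : S →ₗ[ℝ] V ⧸ S)
    (v v' : Basis (Fin r) ℝ V)
    (κ κ' : Fin r → ℕ) {ϖ : ℕ → ℕ} (hϖ : Monotone ϖ) (T : ℕ)
    (h : ∀ t, ∀ x : S, (x : V) ∈ keySpan v' κ' t → φ x ∈ (keySpan v κ t).map S.mkQ) :
    layerWeight v' κ' ϖ T S + layerWeight v κ ϖ T S ≤
      layerWeight v' κ' ϖ T (kerIn φ) + layerWeight v κ ϖ T (rangeOver φ) := by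
  have h1 : (finrank ℝ (kerIn φ) + finrank ℝ (rangeOver φ) : ℤ) = 2 * finrank ℝ S := by
    exact_mod_cast finrank_kerIn_add φ
  have h2 : ∑ t ∈ Finset.range T, ((ϖ (t + 1) : ℤ) - ϖ t) *
        (finrank ℝ ↥(S ⊓ keySpan v' κ' (t + 1)) + finrank ℝ ↥(S ⊓ keySpan v κ (t + 1))) ≤
      ∑ t ∈ Finset.range T, ((ϖ (t + 1) : ℤ) - ϖ t) *
        (finrank ℝ ↥(kerIn φ ⊓ keySpan v' κ' (t + 1)) +
          finrank ℝ ↥(rangeOver φ ⊓ keySpan v κ (t + 1))) := by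
    refine Finset.sum_le_sum fun t _ => mul_le_mul_of_nonneg_left ?_ ?_
    · exact_mod_cast finrank_inf_add_le φ _ _ (h (t + 1))
    · have : (ϖ t : ℤ) ≤ ϖ (t + 1) := by exact_mod_cast hϖ t.le_succ
      linarith
  simp only [mul_add, Finset.sum_add_distrib] at h2
  have h3 : (ϖ 0 : ℤ) * finrank ℝ (kerIn φ) + ϖ 0 * finrank ℝ (rangeOver φ) =
      2 * (ϖ 0 * finrank ℝ S) := by
    rw [← mul_add, h1]; ring
  simp only [layerWeight]
  linarith

lemma Echelon.exists_functional {s : ℕ} {v : Basis (Fin r) ℝ V} {p : Fin s ↪o Fin r}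
    {x : Fin s → V} (h : Echelon v p x) :
    ∃ ξ : Fin r → (V ⧸ Submodule.span ℝ (range x)) →ₗ[ℝ] ℝ, ∀ q (U : Set (Fin r)),
      (∀ b, b ∉ range p → b ∉ U → ξ b q = 0) →
      q ∈ (Submodule.span ℝ (v '' U)).map (Submodule.mkQ _) := by
  classical
  obtain ⟨B, hB1, hB2⟩ := h.exists_basis
  refine ⟨fun b => if hb : b ∉ range p then (Submodule.span ℝ (range x)).liftQ (B.coord b) ?_
    else 0, ?_⟩
  · rw [Submodule.span_le]
    rintro _ ⟨a, rfl⟩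
    rw [← hB1 a]
    simp only [SetLike.mem_coe, LinearMap.mem_ker, Basis.coord_apply, Basis.repr_self]
    rw [Finsupp.single_apply, if_neg]
    rintro rfl
    exact hb ⟨a, rfl⟩
  · intro q U hq
    obtain ⟨y, rfl⟩ := Submodule.mkQ_surjective _ q
    have hy := B.sum_repr y
    rw [← hy, map_sum]
    refine Submodule.sum_mem _ fun b _ => ?_
    rw [map_smul]
    by_cases hb : b ∈ range p
    · obtain ⟨a, rfl⟩ := hb
      have hmem : x a ∈ Submodule.span ℝ (range x) := Submodule.subset_span ⟨a, rfl⟩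
      rw [hB1, Submodule.mkQ_apply, (Submodule.Quotient.mk_eq_zero _).2 hmem, smul_zero]
      exact zero_mem _
    · by_cases hU : b ∈ U
      · rw [hB2 b hb]
        exact Submodule.smul_mem _ _ (Submodule.mem_map_of_mem
          (Submodule.subset_span (mem_image_of_mem v hU)))
      · have h0 := hq b hb hU
        simp only [dif_pos hb] at h0
        rw [Submodule.mkQ_apply, Submodule.liftQ_apply, Basis.coord_apply] at h0
        rw [h0, zero_smul]
        exact zero_mem _

/-- Among all subspaces, one of maximal weight and then of minimal dimension satisfies a
dimension inequality. -/
lemma exists_extremal (v : Fin 3 → Basis (Fin r) ℝ V) (κ : Fin 3 → Fin r → ℕ)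
    (hκ : ∀ i, StrictMono (κ i)) (ϖ : Fin 3 → ℕ → ℕ) (hϖ : ∀ i, Monotone (ϖ i))
    (σ : Equiv.Perm (Fin 3)) (hσ : ∀ i, ϖ (σ i) = ϖ i) (N : ℤ) :
    ∃ (s : ℕ) (p : Fin 3 → Fin s ↪o Fin r) (x : Fin 3 → Fin s → V),
      (∀ i j, Submodule.span ℝ (range (x i)) = Submodule.span ℝ (range (x j))) ∧
      (∀ i, Echelon (v i) (p i) (x i)) ∧
      (∀ (s' : ℕ) (p' : Fin 3 → Fin s' ↪o Fin r) (x' : Fin 3 → Fin s' → V),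
        (∀ i j, Submodule.span ℝ (range (x' i)) = Submodule.span ℝ (range (x' j))) →
        (∀ i, Echelon (v i) (p' i) (x' i)) →
        ∑ i, ∑ a, (ϖ i (κ i (p' i a)) : ℤ) - N * s' ≤
          ∑ i, ∑ a, (ϖ i (κ i (p i a)) : ℤ) - N * s) ∧
      s * (r - s) ≤ ∑ i, (Finset.univ.filter fun z : Fin s × Fin r =>
        z.2 ∉ range (p i) ∧ κ i z.2 < κ (σ i) (p (σ i) z.1)).card := by
  classical
  have hf : Module.Finite ℝ V := Module.Finite.of_basis (v 0)
  have hr : finrank ℝ V = r := by rw [finrank_eq_card_basis (v 0), Fintype.card_fin]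
  obtain ⟨T, hT⟩ : ∃ T, ∀ i b, κ i b ≤ T :=
    ⟨∑ i, ∑ b, κ i b, fun i b => (Finset.single_le_sum (f := κ i) (fun _ _ => Nat.zero_le _)
      (Finset.mem_univ b)).trans (Finset.single_le_sum (f := fun i => ∑ b, κ i b)
        (fun _ _ => Nat.zero_le _) (Finset.mem_univ i))⟩
  set w : Submodule ℝ V → ℤ := fun S =>
    ∑ i, layerWeight (v i) (κ i) (ϖ i) T S - N * finrank ℝ S with hw
  have hwE : ∀ (s' : ℕ) (p' : Fin 3 → Fin s' ↪o Fin r) (x' : Fin 3 → Fin s' → V)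
      (S : Submodule ℝ V), (∀ i, Submodule.span ℝ (range (x' i)) = S) →
      (∀ i, Echelon (v i) (p' i) (x' i)) →
      w S = ∑ i, ∑ a, (ϖ i (κ i (p' i a)) : ℤ) - N * s' := by
    intro s' p' x' S hS hE
    have h1 : finrank ℝ S = s' := by
      rw [← hS 0, finrank_span_eq_card (hE 0).linearIndependent, Fintype.card_fin]
    simp only [hw, h1]
    congr 1
    refine Finset.sum_congr rfl fun i _ => ?_
    rw [← hS i, (hE i).layerWeight_eq (hκ i) (ϖ i) (hT i)]
  have hfr : ∀ S : Submodule ℝ V, finrank ℝ S ≤ r := fun S => hr ▸ S.finrank_le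
  obtain ⟨C, hC⟩ : ∃ C : ℤ, ∀ S, w S ≤ C := by
    refine ⟨∑ i, ∑ b, (ϖ i (κ i b) : ℤ) + |N| * r, fun S => ?_⟩
    choose p x hx hE using fun i => exists_echelon (v i) S rfl
    rw [hwE _ p x S hx hE]
    have h1 : ∀ i, ∑ a, (ϖ i (κ i (p i a)) : ℤ) ≤ ∑ b, (ϖ i (κ i b) : ℤ) := by
      intro i
      rw [← Finset.sum_image (f := fun b => (ϖ i (κ i b) : ℤ)) (g := p i)
        (fun a _ a' _ h => (p i).injective h)]
      exact Finset.sum_le_sum_of_subset_of_nonneg (Finset.subset_univ _) (by simp)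
    have h2 := Finset.sum_le_sum fun i (_ : i ∈ Finset.univ) => h1 i
    have h3 : (finrank ℝ S : ℤ) ≤ r := by exact_mod_cast hfr S
    have h4 : -(N * finrank ℝ S) ≤ |N| * r := by
      calc -(N * finrank ℝ S) = (-N) * finrank ℝ S := by ring
        _ ≤ |N| * finrank ℝ S := mul_le_mul_of_nonneg_right (neg_le_abs N) (by positivity)
        _ ≤ |N| * r := mul_le_mul_of_nonneg_left h3 (abs_nonneg N)
    linarith
  obtain ⟨_, ⟨S, rfl⟩, hmax⟩ := Int.exists_greatest_of_bdd
    (P := fun z => ∃ S, z = (r + 1 : ℤ) * w S - finrank ℝ S)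
    ⟨(r + 1) * C, by
      rintro _ ⟨S, rfl⟩
      have := mul_le_mul_of_nonneg_left (hC S) (by positivity : (0 : ℤ) ≤ r + 1)
      have h0 : (0 : ℤ) ≤ finrank ℝ S := by positivity
      linarith⟩ ⟨_, ⊥, rfl⟩
  replace hmax : ∀ S', (r + 1 : ℤ) * w S' - finrank ℝ S' ≤ (r + 1) * w S - finrank ℝ S :=
    fun S' => hmax _ ⟨S', rfl⟩
  have hwmax : ∀ S', w S' ≤ w S := by
    intro S'
    by_contra! hlt
    have h1 := hmax S'
    have h2 : (finrank ℝ S' : ℤ) ≤ r := by exact_mod_cast hfr S'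
    have h0 : (0 : ℤ) ≤ finrank ℝ S := by positivity
    nlinarith
  have hwmin : ∀ S' : Submodule ℝ V, finrank ℝ S' < finrank ℝ S → w S' < w S := by
    intro S' hS'
    by_contra! hle
    have h1 := hmax S'
    have h2 : (finrank ℝ S' : ℤ) < finrank ℝ S := by exact_mod_cast hS'
    have := mul_le_mul_of_nonneg_left hle (by positivity : (0 : ℤ) ≤ r + 1)
    linarith
  obtain ⟨s, hs⟩ : ∃ s, finrank ℝ S = s := ⟨_, rfl⟩
  choose p x hx hE using fun i => exists_echelon (v i) S hs
  refine ⟨s, p, x, fun i j => by rw [hx i, hx j], hE, ?_, ?_⟩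
  · intro s' p' x' hx' hE'
    rw [← hwE s p x S hx hE, ← hwE s' p' x' _ (fun i => hx' i 0) hE']
    exact hwmax _
  have hzero : ∀ φ : S →ₗ[ℝ] V ⧸ S, (∀ i t, ∀ y : S, (y : V) ∈ keySpan (v (σ i)) (κ (σ i)) t →
      φ y ∈ (keySpan (v i) (κ i) t).map S.mkQ) → φ = 0 := by
    intro φ hφ
    by_contra hne
    have h1 : ∀ i, layerWeight (v (σ i)) (κ (σ i)) (ϖ (σ i)) T S +
        layerWeight (v i) (κ i) (ϖ i) T S ≤
        layerWeight (v (σ i)) (κ (σ i)) (ϖ (σ i)) T (kerIn φ) +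
          layerWeight (v i) (κ i) (ϖ i) T (rangeOver φ) := by
      intro i
      rw [hσ i]
      exact layerWeight_add_le φ _ _ _ _ (hϖ i) T (hφ i)
    have h2 := Finset.sum_le_sum fun i (_ : i ∈ Finset.univ) => h1 i
    rw [Finset.sum_add_distrib, Finset.sum_add_distrib,
      Equiv.sum_comp σ (fun i => layerWeight (v i) (κ i) (ϖ i) T S),
      Equiv.sum_comp σ (fun i => layerWeight (v i) (κ i) (ϖ i) T (kerIn φ))] at h2
    have h3 : (finrank ℝ (kerIn φ) + finrank ℝ (rangeOver φ) : ℤ) = 2 * finrank ℝ S := by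
      exact_mod_cast finrank_kerIn_add φ
    have h4 : 2 * w S ≤ w (kerIn φ) + w (rangeOver φ) := by
      simp only [hw]
      have : N * finrank ℝ (kerIn φ) + N * finrank ℝ (rangeOver φ) = N * (2 * finrank ℝ S) := by
        rw [← mul_add, h3]
      linarith
    have h5 := hwmax (rangeOver φ)
    have h6 : finrank ℝ (kerIn φ) < finrank ℝ S := by
      have h7 : finrank ℝ (kerIn φ) = finrank ℝ (LinearMap.ker φ) :=
        Submodule.finrank_map_subtype_eq _ _
      rw [h7]
      refine Submodule.finrank_lt ?_
      rwa [Ne, LinearMap.ker_eq_top]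
    have h7 := hwmin _ h6
    linarith
  choose ξ hξ using fun i => (hE i).exists_functional
  by_contra! hlt
  have hxS : ∀ i a, x i a ∈ S := fun i a => by
    rw [← hx i]; exact Submodule.subset_span ⟨a, rfl⟩
  let I : Type := Σ i : Fin 3, {z : Fin s × Fin r //
    z.2 ∉ range (p i) ∧ κ i z.2 < κ (σ i) (p (σ i) z.1)}
  let e : ∀ i, (V ⧸ S) →ₗ[ℝ] V ⧸ Submodule.span ℝ (range (x i)) := fun i =>
    S.liftQ (Submodule.mkQ _) (by rw [Submodule.ker_mkQ, hx i])
  let Ψ : (S →ₗ[ℝ] V ⧸ S) →ₗ[ℝ] (I → ℝ) := LinearMap.pi fun z =>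
    (ξ z.1 z.2.1.2 ∘ₗ e z.1) ∘ₗ LinearMap.applyₗ ⟨x (σ z.1) z.2.1.1, hxS _ _⟩
  have hcard : finrank ℝ (I → ℝ) < finrank ℝ (S →ₗ[ℝ] V ⧸ S) := by
    rw [Module.finrank_linearMap, hs]
    have h1 := S.finrank_quotient_add_finrank
    rw [hs, hr] at h1
    have h2 : finrank ℝ (V ⧸ S) = r - s := by omega
    rw [h2]
    simp only [finrank_fintype_fun_eq_card, I, Fintype.card_sigma, Fintype.card_subtype]
    exact hlt
  obtain ⟨φ, hφ, hne⟩ := Submodule.exists_mem_ne_zero_of_ne_bot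
    (LinearMap.ker_ne_bot_of_finrank_lt (f := Ψ) hcard)
  refine hne (hzero φ fun i t y hy => ?_)
  have hU : IsUpperSet {b | t ≤ κ (σ i) b} := fun a b hab ha =>
    le_trans ha ((hκ _).monotone hab)
  have hy' : (y : V) ∈ Submodule.span ℝ (x (σ i) '' {a | p (σ i) a ∈ {b | t ≤ κ (σ i) b}}) := by
    rw [← (hE (σ i)).inf_span hU, hx]
    exact ⟨y.2, hy⟩
  have hmain : ∀ a, t ≤ κ (σ i) (p (σ i) a) →
      φ ⟨x (σ i) a, hxS _ _⟩ ∈ (keySpan (v i) (κ i) t).map S.mkQ := by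
    intro a ha
    have := hξ i (e i (φ ⟨x (σ i) a, hxS _ _⟩)) {b | t ≤ κ i b} ?_
    · obtain ⟨z, hz, hze⟩ := this
      refine ⟨z, hz, ?_⟩
      obtain ⟨y', hy'⟩ := S.mkQ_surjective (φ ⟨x (σ i) a, hxS _ _⟩)
      rw [← hy'] at hze ⊢
      have h8 : e i (S.mkQ y') = Submodule.mkQ _ y' := by
        simp only [e, Submodule.mkQ_apply, Submodule.liftQ_apply]
      rw [h8] at hze
      rw [Submodule.mkQ_apply, Submodule.mkQ_apply, Submodule.Quotient.eq] at hze ⊢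
      rwa [hx i] at hze
    · intro b hb hbt
      have h9 := congrFun (LinearMap.mem_ker.1 hφ) ⟨i, (a, b), hb, ?_⟩
      · simpa [Ψ] using h9
      · simp only [mem_ofPred_eq, not_le] at hbt
        exact lt_of_lt_of_le hbt ha
  have hsub : Submodule.span ℝ (x (σ i) '' {a | p (σ i) a ∈ {b | t ≤ κ (σ i) b}}) ≤
      (((keySpan (v i) (κ i) t).map S.mkQ).comap φ).map S.subtype := by
    rw [Submodule.span_le]
    rintro _ ⟨a, ha, rfl⟩
    exact ⟨⟨x (σ i) a, hxS _ _⟩, hmain a ha, rfl⟩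
  obtain ⟨y', hy1, hy2⟩ := hsub hy'
  have : y' = y := Subtype.ext hy2
  rwa [this] at hy1

end Extremal

section Types

variable {n s t : ℕ}

/-- Triples of families of `n` vectors in `ℝⁿ`; generically, triples of flags. -/
abbrev Frames (n : ℕ) : Type := Fin 3 → Fin n → Fin n → ℝ

/-- There is a subspace whose reduced echelon bases with respect to the three families in `v` have
pivots at the positions `P`. -/
def HasSub (v : Frames n) (P : Fin 3 → Fin s ↪o Fin n) : Prop :=
  ∃ x : Fin 3 → Fin s → Fin n → ℝ,
    (∀ i j, Submodule.span ℝ (range (x i)) = Submodule.span ℝ (range (x j))) ∧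
    ∀ i, Echelon (v i) (P i) (x i)

/-- A triple of position vectors is thick if it is the type of some subspace for sufficiently many
triples of flags. -/
def Thick (P : Fin 3 → Fin s ↪o Fin n) : Prop := ¬ Thin {v : Frames n | HasSub v P}

/-- The expected dimension of the intersection of three Schubert cells. -/
def edim (P : Fin 3 → Fin s ↪o Fin n) : ℤ :=
  s * ((n : ℤ) - s) - ∑ i, ∑ a, (((P i a : ℕ) : ℤ) - (a : ℕ))

open Classical in
/-- The vectors obtained from a subspace spanned by `Y`, bases `A` of it and vectors `G` at the
positions which are not pivots. -/
noncomputable def param {R : Type*} [CommRing R] (P : Fin 3 → Fin s ↪o Fin n)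
    (Y : Fin s → Fin n → R) (A : Fin 3 → Fin s → Fin s → R) (G : Fin 3 → Fin n → Fin n → R)
    (c : Fin 3 → Fin s → Fin n → R) (i : Fin 3) : Fin n → Fin n → R :=
  Function.extend (P i) (fun (a : Fin s) (j : Fin n) => ∑ k, A i a k * Y k j -
    ∑ b, if b ∉ range (P i) ∧ P i a < b then c i a b * G i b j else 0) (G i)

lemma param_apply {R : Type*} [CommRing R] (P : Fin 3 → Fin s ↪o Fin n) (Y : Fin s → Fin n → R)
    (A : Fin 3 → Fin s → Fin s → R) (G : Fin 3 → Fin n → Fin n → R)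
    (c : Fin 3 → Fin s → Fin n → R) (i : Fin 3) (a : Fin s) (j : Fin n)
    [∀ b, Decidable (b ∉ range (P i) ∧ P i a < b)] :
    param P Y A G c i (P i a) j = ∑ k, A i a k * Y k j -
      ∑ b, if b ∉ range (P i) ∧ P i a < b then c i a b * G i b j else 0 := by
  classical
  rw [param, (P i).injective.extend_apply]
  congr 1
  refine Finset.sum_congr rfl fun b _ => ?_
  congr

lemma param_apply' {R : Type*} [CommRing R] (P : Fin 3 → Fin s ↪o Fin n) (Y : Fin s → Fin n → R)
    (A : Fin 3 → Fin s → Fin s → R) (G : Fin 3 → Fin n → Fin n → R)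
    (c : Fin 3 → Fin s → Fin n → R) (i : Fin 3) {b : Fin n} (hb : b ∉ range (P i)) :
    param P Y A G c i b = G i b := by
  rw [param, Function.extend_apply' _ _ _ (by simpa using hb)]

lemma param_emb (P : Fin 3 → Fin s ↪o Fin n) (Y : Fin s → Fin n → ℝ) (A : Frames s) (G : Frames n)
    (c : Fin 3 → Fin s → Fin n → ℝ) (i : Fin 3) (a : Fin s) :
    param P Y A G c i (P i a) - Fintype.linearCombination ℝ Y (A i a) ∈
      Submodule.span ℝ (param P Y A G c i '' {b | b ∉ range (P i) ∧ P i a < b}) := by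
  classical
  have h : param P Y A G c i (P i a) - Fintype.linearCombination ℝ Y (A i a) =
      - ∑ b, if b ∉ range (P i) ∧ P i a < b then c i a b • param P Y A G c i b else 0 := by
    ext j
    rw [Pi.sub_apply, param_apply, Fintype.linearCombination_apply, Pi.neg_apply,
      Finset.sum_apply, Finset.sum_apply]
    simp only [Pi.smul_apply, smul_eq_mul]
    rw [sub_sub_cancel_left]
    congr 1
    refine Finset.sum_congr rfl fun b _ => ?_
    split_ifs with hb
    · rw [param_apply' _ _ _ _ _ _ hb.1]; rfl
    · rfl
  rw [h]
  refine neg_mem (Submodule.sum_mem _ fun b _ => ?_)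
  split_ifs with hb
  · exact Submodule.smul_mem _ _ (Submodule.subset_span (mem_image_of_mem _ hb))
  · exact zero_mem _

lemma hasSub_param_comp (P : Fin 3 → Fin s ↪o Fin n) (P' : Fin 3 → Fin t ↪o Fin s)
    (Y : Fin s → Fin n → ℝ) (A : Frames s) (G : Frames n) (c : Fin 3 → Fin s → Fin n → ℝ)
    (h : HasSub A P') : HasSub (param P Y A G c) fun i => (P' i).trans (P i) := by
  obtain ⟨x, hx, hE⟩ := h
  refine ⟨fun i a => Fintype.linearCombination ℝ Y (x i a), fun i j => ?_, fun i a => ?_⟩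
  · have hr : ∀ i, range (fun a => Fintype.linearCombination ℝ Y (x i a)) =
        Fintype.linearCombination ℝ Y '' range (x i) := fun i => by
      rw [← range_comp]; rfl
    rw [hr, hr, ← Submodule.map_span, ← Submodule.map_span, hx i j]
  · set W := Submodule.span ℝ (param P Y A G c i ''
      {b | b ∉ range ((P' i).trans (P i)) ∧ (P' i).trans (P i) a < b}) with hW
    have h1 : ∀ d, P' i a ≤ d →
        param P Y A G c i (P i d) - Fintype.linearCombination ℝ Y (A i d) ∈ W := by
      intro d hd
      refine Submodule.span_mono (image_mono ?_) (param_emb P Y A G c i d)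
      rintro b ⟨hb, hlt⟩
      refine ⟨?_, lt_of_le_of_lt ((P i).monotone hd) hlt⟩
      rintro ⟨e, rfl⟩
      exact hb ⟨P' i e, rfl⟩
    have h2 : Submodule.span ℝ (A i '' {b | b ∉ range (P' i) ∧ P' i a < b}) ≤
        W.comap (Fintype.linearCombination ℝ Y) := by
      rw [Submodule.span_le]
      rintro _ ⟨d, ⟨hd, hlt⟩, rfl⟩
      have h3 : param P Y A G c i (P i d) ∈ W := by
        refine Submodule.subset_span (mem_image_of_mem _ ⟨?_, (P i).strictMono hlt⟩)
        rintro ⟨e, he⟩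
        exact hd ⟨e, (P i).injective he⟩
      have := sub_mem h3 (h1 d hlt.le)
      rwa [sub_sub_cancel] at this
    have h4 := h2 (hE i a)
    rw [Submodule.mem_comap, map_sub] at h4
    have := add_mem (h1 _ le_rfl) h4
    rwa [sub_add_sub_cancel] at this

lemma HasSub.exists_param {v : Frames n} {P : Fin 3 → Fin s ↪o Fin n} (h : HasSub v P) :
    ∃ (Y : Fin s → Fin n → ℝ) (A : Frames s) (G : Frames n) (c : Fin 3 → Fin s → Fin n → ℝ),
      v = param P Y A G c ∧ A 0 = fun a => Pi.single a 1 := by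
  classical
  obtain ⟨x, hx, hE⟩ := h
  have hA : ∀ i a, ∃ d : Fin s → ℝ, ∑ k, d k • x 0 k = x i a := by
    intro i a
    rw [← Submodule.mem_span_range_iff_exists_fun, hx 0 i]
    exact Submodule.subset_span ⟨a, rfl⟩
  choose A hA using hA
  have hc : ∀ i a, ∃ d : Fin n → ℝ, v i (P i a) - x i a =
      ∑ b, if b ∉ range (P i) ∧ P i a < b then d b • v i b else 0 := by
    intro i a
    have h := hE i a
    have hS : {b | b ∉ range (P i) ∧ P i a < b} =
        ((Finset.univ.filter fun b => b ∉ range (P i) ∧ P i a < b : Finset (Fin n)) :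
          Set (Fin n)) := by
      ext b; simp
    rw [hS, Submodule.mem_span_image_finset_iff_exists_fun'] at h
    obtain ⟨d, hd⟩ := h
    exact ⟨d, by rw [← hd, Finset.sum_filter]⟩
  choose c hc using hc
  refine ⟨x 0, fun i => if i = 0 then fun a => Pi.single a 1 else A i, v,
    fun i a b => - c i a b, ?_, by simp⟩
  funext i b
  by_cases hb : b ∈ range (P i)
  · obtain ⟨a, rfl⟩ := hb
    funext j
    rw [param_apply]
    have h1 : x i a j = ∑ k, (if i = 0 then fun a => Pi.single a 1 else A i) a k * x 0 k j := by
      split_ifs with hi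
      · subst hi
        simp [Pi.single_apply]
      · rw [← hA i a]; simp
    rw [← h1]
    have h2 := congrFun (hc i a) j
    rw [Pi.sub_apply, Finset.sum_apply] at h2
    rw [eq_comm, sub_eq_iff_eq_add', ← sub_eq_iff_eq_add, ← neg_sub, h2, ← Finset.sum_neg_distrib]
    refine Finset.sum_congr rfl fun b _ => ?_
    split_ifs <;> simp
  · rw [param_apply' _ _ _ _ _ _ hb]

end Types

section Edim

variable {n s t : ℕ}

lemma thin_range_eval {σ ι : Type} [Fintype σ] [Fintype ι] (p : ι → MvPolynomial σ ℝ)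
    (h : Fintype.card σ < Fintype.card ι) :
    Thin (range fun (w : σ → ℝ) (i : ι) => MvPolynomial.eval w (p i)) := by
  have h1 : ¬ AlgebraicIndependent ℝ p := by
    intro hp
    have := hp.cardinalMk_le_trdeg
    rw [MvPolynomial.trdeg_of_isDomain, Cardinal.lift_id, Cardinal.mk_fintype,
      Cardinal.mk_fintype, Nat.cast_le] at this
    omega
  rw [algebraicIndependent_iff] at h1
  push Not at h1
  obtain ⟨f, hf, hf0⟩ := h1
  refine ⟨fun v => MvPolynomial.eval v f, ?_, ?_, ?_⟩
  · rw [contDiff_omega_iff_analyticOnNhd]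
    exact AnalyticOnNhd.eval_mvPolynomial f
  · by_contra! hc
    exact hf0 (MvPolynomial.funext fun x => by rw [hc, map_zero])
  · rintro _ ⟨w, rfl⟩
    have := congrArg (MvPolynomial.eval w) hf
    rw [map_zero, MvPolynomial.aeval_def, MvPolynomial.hom_eval₂] at this
    have hid : (MvPolynomial.eval w).comp (algebraMap ℝ (MvPolynomial σ ℝ)) = RingHom.id ℝ := by
      ext x; simp
    rw [hid] at this
    exact this

lemma param_map {R R' : Type*} [CommRing R] [CommRing R'] (f : R →+* R')
    (P : Fin 3 → Fin s ↪o Fin n) (Y : Fin s → Fin n → R)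
    (A : Fin 3 → Fin s → Fin s → R) (G : Fin 3 → Fin n → Fin n → R)
    (c : Fin 3 → Fin s → Fin n → R) (i : Fin 3) (b j : Fin n) :
    f (param P Y A G c i b j) = param P (fun k j => f (Y k j)) (fun i a k => f (A i a k))
      (fun i b j => f (G i b j)) (fun i a b => f (c i a b)) i b j := by
  classical
  by_cases hb : b ∈ range (P i)
  · obtain ⟨a, rfl⟩ := hb
    rw [param_apply, param_apply, map_sub, map_sum, map_sum]
    congr 1
    · simp
    · refine Finset.sum_congr rfl fun b _ => ?_
      split_ifs <;> simp
  · rw [param_apply' _ _ _ _ _ _ hb, param_apply' _ _ _ _ _ _ hb]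

lemma param_congr {R : Type*} [CommRing R] (P : Fin 3 → Fin s ↪o Fin n) (Y : Fin s → Fin n → R)
    (A : Fin 3 → Fin s → Fin s → R) {G G' : Fin 3 → Fin n → Fin n → R}
    {c c' : Fin 3 → Fin s → Fin n → R} (hG : ∀ i, ∀ b ∉ range (P i), G i b = G' i b)
    (hc : ∀ i a, ∀ b ∉ range (P i), P i a < b → c i a b = c' i a b) :
    param P Y A G c = param P Y A G' c' := by
  classical
  funext i b
  by_cases hb : b ∈ range (P i)
  · obtain ⟨a, rfl⟩ := hb
    funext j
    rw [param_apply, param_apply]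
    congr 1
    refine Finset.sum_congr rfl fun b _ => ?_
    split_ifs with h
    · rw [hG _ _ h.1, hc _ _ _ h.1 h.2]
    · rfl
  · rw [param_apply' _ _ _ _ _ _ hb, param_apply' _ _ _ _ _ _ hb, hG i b hb]

lemma card_range_lt (p : Fin s ↪o Fin n) (a : Fin s)
    [DecidablePred fun b => b ∈ range p ∧ b < p a] :
    (Finset.univ.filter fun b => b ∈ range p ∧ b < p a).card = a := by
  rw [show (Finset.univ.filter fun b => b ∈ range p ∧ b < p a) =
    (Finset.univ.filter fun c => c < a).map p.toEmbedding by
      ext b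
      simp only [Finset.mem_filter_univ, Finset.mem_map, RelEmbedding.coe_toEmbedding]
      constructor
      · rintro ⟨⟨c, rfl⟩, h⟩
        exact ⟨c, p.lt_iff_lt.1 h, rfl⟩
      · rintro ⟨c, h, rfl⟩
        exact ⟨⟨c, rfl⟩, p.lt_iff_lt.2 h⟩, Finset.card_map]
  rw [show (Finset.univ.filter fun c => c < a) = Finset.Iio a by ext; simp, Fin.card_Iio]

lemma card_compl_lt (p : Fin s ↪o Fin n) (a : Fin s)
    [DecidablePred fun b => b ∉ range p ∧ b < p a] :
    (Finset.univ.filter fun b => b ∉ range p ∧ b < p a).card + a = p a := by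
  classical
  rw [← card_range_lt p a, add_comm, ← Finset.card_union_of_disjoint]
  · rw [← Finset.filter_or]
    simp only [← or_and_right, em, true_and]
    rw [show (Finset.univ.filter fun b => b < p a) = Finset.Iio (p a) by ext; simp, Fin.card_Iio]
  · rw [Finset.disjoint_filter]
    tauto

lemma card_compl (p : Fin s ↪o Fin n) [DecidablePred fun b => b ∉ range p] :
    (Finset.univ.filter fun b => b ∉ range p).card + s = n := by
  classical
  have h := Finset.card_filter_add_card_filter_not (s := Finset.univ) (fun b => b ∉ range p)
  have h2 : (Finset.univ.filter fun b => ¬ b ∉ range p) =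
      Finset.univ.map p.toEmbedding := by
    ext b; simp
  rw [h2, Finset.card_map] at h
  simpa using h

lemma card_compl_gt (p : Fin s ↪o Fin n) (a : Fin s)
    [DecidablePred fun b => b ∉ range p ∧ p a < b] :
    (Finset.univ.filter fun b => b ∉ range p ∧ p a < b).card + s + p a = n + a := by
  classical
  have h1 := card_compl p
  have h2 := card_compl_lt p a
  have h3 : (Finset.univ.filter fun b => b ∉ range p) =
      (Finset.univ.filter fun b => b ∉ range p ∧ p a < b) ∪
      (Finset.univ.filter fun b => b ∉ range p ∧ b < p a) := by
    rw [← Finset.filter_or]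
    refine Finset.filter_congr fun b _ => ⟨fun h => ?_, by tauto⟩
    have : p a ≠ b := fun e => h ⟨a, e⟩
    rcases this.lt_or_gt with h' | h'
    · exact Or.inl ⟨h, h'⟩
    · exact Or.inr ⟨h, h'⟩
  rw [h3, Finset.card_union_of_disjoint] at h1
  · omega
  · rw [Finset.disjoint_filter]
    rintro b - ⟨-, h⟩ ⟨-, h'⟩
    exact lt_asymm h h'

open Classical in
/-- The parameters of the subspaces with pivots `P`, together with the flags adapted to them. -/
abbrev ParamIndex (P : Fin 3 → Fin s ↪o Fin n) : Type :=
  ((Fin s × Fin n) ⊕ (Fin 2 × Fin s × Fin s)) ⊕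
    ((Σ i, {b // b ∉ range (P i)} × Fin n) ⊕
      (Σ i, Σ a, {b // b ∉ range (P i) ∧ P i a < b}))

open Classical in
lemma card_paramIndex (P : Fin 3 → Fin s ↪o Fin n) :
    (Fintype.card (ParamIndex P) : ℤ) = 3 * n * n + edim P := by
  have h1 : ∀ i, (Fintype.card {b // b ∉ range (P i)} : ℤ) = n - s := by
    intro i
    have := card_compl (P i)
    rw [Fintype.card_subtype]
    omega
  have h2 : ∀ i a, (Fintype.card {b // b ∉ range (P i) ∧ P i a < b} : ℤ) =
      (n - s) - ((P i a : ℕ) - (a : ℕ)) := by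
    intro i a
    have := card_compl_gt (P i) a
    rw [Fintype.card_subtype]
    omega
  simp only [ParamIndex, Fintype.card_sum, Fintype.card_prod, Fintype.card_sigma, Fintype.card_fin,
    Nat.cast_add, Nat.cast_mul, Nat.cast_sum, h1, h2, edim, Finset.sum_sub_distrib,
    Finset.sum_const, Finset.card_univ, nsmul_eq_mul]
  push_cast
  ring

open Classical in
lemma Thick.edim_nonneg {P : Fin 3 → Fin s ↪o Fin n} (hP : Thick P) : 0 ≤ edim P := by
  by_contra! hlt
  apply hP
  let σ := ParamIndex P
  let Y : Fin s → Fin n → MvPolynomial σ ℝ := fun k j => MvPolynomial.X (Sum.inl (Sum.inl (k, j)))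
  let A : Fin 3 → Fin s → Fin s → MvPolynomial σ ℝ := Fin.cases (fun a => Pi.single a 1)
    fun i a k => MvPolynomial.X (Sum.inl (Sum.inr (i, a, k)))
  let G : Fin 3 → Fin n → Fin n → MvPolynomial σ ℝ := fun i b j =>
    if h : b ∉ range (P i) then MvPolynomial.X (Sum.inr (Sum.inl ⟨i, ⟨b, h⟩, j⟩)) else 0
  let c : Fin 3 → Fin s → Fin n → MvPolynomial σ ℝ := fun i a b =>
    if h : b ∉ range (P i) ∧ P i a < b then
      MvPolynomial.X (Sum.inr (Sum.inr ⟨i, a, ⟨b, h⟩⟩)) else 0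
  have hthin := thin_range_eval (fun z : Fin 3 × Fin n × Fin n => param P Y A G c z.1 z.2.1 z.2.2) (by
    have := card_paramIndex P
    zify
    rw [this]
    simp only [Fintype.card_prod, Fintype.card_fin]
    push_cast
    linarith)
  have hpre := hthin.preimage (F := Frames n)
    (f := fun v (z : Fin 3 × Fin n × Fin n) => v z.1 z.2.1 z.2.2) (by fun_prop)
    (fun w => ⟨fun i b j => w (i, b, j), rfl⟩)
  refine hpre.mono fun v hv => ?_
  obtain ⟨Y', A', G', c', rfl, hA⟩ := HasSub.exists_param hv
  refine ⟨Sum.elim (Sum.elim (fun z => Y' z.1 z.2) fun z => A' z.1.succ z.2.1 z.2.2)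
    (Sum.elim (fun z => G' z.1 z.2.1 z.2.2) fun z => c' z.1 z.2.1 z.2.2), ?_⟩
  funext ⟨i, b, j⟩
  dsimp only
  rw [param_map]
  refine congrFun (congrFun (congrFun (?_ : param P _ _ _ _ = param P _ _ _ _) i) b) j
  have hAA : (fun i a k => MvPolynomial.eval (Sum.elim (Sum.elim (fun z : Fin s × Fin n => Y' z.1 z.2)
      fun z : Fin 2 × Fin s × Fin s => A' z.1.succ z.2.1 z.2.2)
      (Sum.elim (fun z : Σ i, {b // b ∉ range (P i)} × Fin n => G' z.1 z.2.1 z.2.2)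
        fun z : Σ i, Σ a, {b // b ∉ range (P i) ∧ P i a < b} => c' z.1 z.2.1 z.2.2)) (A i a k)) = A' := by
    funext i a k
    refine Fin.cases ?_ (fun i => ?_) i
    · simp only [A, Fin.cases_zero, hA, Pi.single_apply]
      split_ifs <;> simp
    · simp [A]
  rw [hAA]
  have hYY : ∀ k j, MvPolynomial.eval (Sum.elim (Sum.elim (fun z : Fin s × Fin n => Y' z.1 z.2)
      fun z : Fin 2 × Fin s × Fin s => A' z.1.succ z.2.1 z.2.2)
      (Sum.elim (fun z : Σ i, {b // b ∉ range (P i)} × Fin n => G' z.1 z.2.1 z.2.2)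
        fun z : Σ i, Σ a, {b // b ∉ range (P i) ∧ P i a < b} => c' z.1 z.2.1 z.2.2)) (Y k j) = Y' k j := by
    intro k j
    simp [Y]
  simp only [hYY]
  refine param_congr P _ _ (fun i b hb => ?_) fun i a b hb hab => ?_
  · funext j
    simp only [G, dif_pos hb, MvPolynomial.eval_X]
    rfl
  · simp only [c, dif_pos (And.intro hb hab), MvPolynomial.eval_X]
    rfl

lemma contDiff_param (P : Fin 3 → Fin s ↪o Fin n) {E : Type*} [NormedAddCommGroup E]
    [NormedSpace ℝ E] {Y : E → Fin s → Fin n → ℝ} {A : E → Frames s} {G : E → Frames n}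
    {c : E → Fin 3 → Fin s → Fin n → ℝ} (hY : ContDiff ℝ ω Y) (hA : ContDiff ℝ ω A)
    (hG : ContDiff ℝ ω G) (hc : ContDiff ℝ ω c) :
    ContDiff ℝ ω fun z => param P (Y z) (A z) (G z) (c z) := by
  classical
  rw [contDiff_pi]; intro i
  rw [contDiff_pi]; intro b
  rw [contDiff_pi]; intro j
  by_cases hb : b ∈ range (P i)
  · obtain ⟨a, rfl⟩ := hb
    simp only [param_apply]
    refine ContDiff.sub (ContDiff.sum fun k _ => ?_) (ContDiff.sum fun b _ => ?_)
    · fun_prop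
    · split_ifs
      · fun_prop
      · exact contDiff_const
  · simp only [param_apply' _ _ _ _ _ _ hb]
    fun_prop

lemma Thick.comp {P : Fin 3 → Fin s ↪o Fin n} {P' : Fin 3 → Fin t ↪o Fin s} (hP : Thick P)
    (hP' : Thick P') : Thick fun i => (P' i).trans (P i) := by
  rintro ⟨h, h1, h2, h3⟩
  apply hP
  refine ⟨h, h1, h2, fun v hv => ?_⟩
  by_contra hne
  obtain ⟨Y, A, G, c, rfl, -⟩ := HasSub.exists_param hv
  refine hP' ⟨fun A' => h (param P Y A' G c), h1.comp ?_, ⟨A, hne⟩, fun A' hA' =>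
    h3 _ (hasSub_param_comp P P' Y A' G c hA')⟩
  exact contDiff_param P contDiff_const contDiff_id contDiff_const contDiff_const

end Edim

section Extension

variable {n s N : ℕ}

/-- All the families in `v` are bases. -/
def Indep (v : Frames n) : Prop := ∀ i, LinearIndependent ℝ (v i)

lemma isOpen_indep : IsOpen {v : Frames n | Indep v} := by
  have : {v : Frames n | Indep v} =
      ⋂ i, (fun v : Frames n => v i) ⁻¹' {w | LinearIndependent ℝ w} := by
    ext v; simp [Indep]
  rw [this]
  exact isOpen_iInter_of_finite fun i => isOpen_setOfPred_linearIndependent.preimage (by fun_prop)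

lemma exists_indep : ∃ v : Frames n, Indep v :=
  ⟨fun _ => Pi.basisFun ℝ (Fin n), fun _ => (Pi.basisFun ℝ (Fin n)).linearIndependent⟩

lemma thin_not_indep : Thin {v : Frames n | ¬ Indep v} := by
  refine (Thin.iUnion (ι := Fin 3) (D := fun i => {v : Frames n | ¬ LinearIndependent ℝ (v i)})
    fun i => ?_).mono fun v hv => ?_
  · refine ⟨fun v => (Matrix.of (v i)).det, contDiff_matrix_det (by fun_prop),
      ⟨fun _ => (1 : Matrix (Fin n) (Fin n) ℝ), ?_⟩, fun v hv => ?_⟩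
    · change (1 : Matrix (Fin n) (Fin n) ℝ).det ≠ 0
      simp
    · by_contra h
      apply hv
      exact Matrix.linearIndependent_rows_iff_isUnit.2
        ((Matrix.isUnit_iff_isUnit_det _).2 (isUnit_iff_ne_zero.2 h))
  · simpa [Indep] using hv

/-- Every system of conditions `u i b ⬝ᵥ φ (v i a) = c i a b` with `b < y i a` on a linear map `φ`
is solvable; this expresses the vanishing of an `Ext` group. -/
def ExtZero {r : ℕ} {V : Type*} [AddCommGroup V] [Module ℝ V] (y : Fin 3 → Fin r → ℕ)
    (v : Fin 3 → Fin r → V) (u : Frames N) : Prop :=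
  ∀ c : Fin 3 → Fin r → Fin N → ℝ, ∃ φ : V →ₗ[ℝ] (Fin N → ℝ),
    ∀ i a b, b.val < y i a → u i b ⬝ᵥ φ (v i a) = c i a b

lemma exists_compl_emb (p : Fin s ↪o Fin n) (h : s + N = n) :
    ∃ q : Fin N ↪o Fin n, range q = (range p)ᶜ ∧
      ∀ m a, p a < q m ↔ (p a : ℕ) ≤ (m : ℕ) + a := by
  classical
  have hc : (Finset.univ.filter fun b => b ∉ range p).card = N := by
    have := card_compl p
    omega
  set q := (Finset.univ.filter fun b => b ∉ range p).orderEmbOfFin hc with hq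
  have hr : range q = (range p)ᶜ := by
    rw [hq, Finset.range_orderEmbOfFin]
    ext b; simp
  refine ⟨q, hr, fun m a => ?_⟩
  have h1 := card_compl_lt p a
  have h2 := card_range_lt q m
  have hm : ∀ b, b ∈ range q ↔ b ∉ range p := fun b => by rw [hr]; rfl
  simp only [hm] at h2
  constructor
  · intro hlt
    have : (Finset.univ.filter fun b => b ∉ range p ∧ b < p a).card ≤
        (Finset.univ.filter fun b => b ∉ range p ∧ b < q m).card :=
      Finset.card_le_card fun b hb => by
        rw [Finset.mem_filter_univ] at hb ⊢
        exact ⟨hb.1, hb.2.trans hlt⟩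
    omega
  · intro hle
    by_contra hlt
    have hqm : q m ∉ range p := (hm _).1 ⟨m, rfl⟩
    have hlt' : q m < p a := lt_of_le_of_ne (not_lt.1 hlt) fun e => hqm ⟨a, e.symm⟩
    have : (Finset.univ.filter fun b => b ∉ range p ∧ b < q m).card <
        (Finset.univ.filter fun b => b ∉ range p ∧ b < p a).card := by
      refine Finset.card_lt_card ((Finset.ssubset_iff_of_subset fun b hb => ?_).2 ⟨q m, ?_, ?_⟩)
      · rw [Finset.mem_filter_univ] at hb ⊢
        exact ⟨hb.1, hb.2.trans hlt'⟩
      · rw [Finset.mem_filter_univ]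
        exact ⟨hqm, hlt'⟩
      · simp
    omega

lemma hasSub_param (P : Fin 3 → Fin s ↪o Fin n) (Y : Fin s → Fin n → ℝ) {A : Frames s}
    (hA : Indep A) (G : Frames n) (c : Fin 3 → Fin s → Fin n → ℝ) :
    HasSub (param P Y A G c) P := by
  refine hasSub_param_comp P (fun _ => RelEmbedding.refl _) Y A G c
    ⟨A, fun i j => ?_, fun i a => ?_⟩
  · have h : ∀ i, Submodule.span ℝ (range (A i)) = ⊤ := fun i =>
      (hA i).span_eq_top_of_card_eq_finrank' (by simp)
    rw [h, h]
  · simp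

lemma hasDerivAt_param (P : Fin 3 → Fin s ↪o Fin n) (Y Y' : Fin s → Fin n → ℝ) (A A' : Frames s)
    (G G' : Frames n) (c' : Fin 3 → Fin s → Fin n → ℝ) {W : Frames n}
    (h1 : ∀ i, ∀ b ∉ range (P i), W i b = G' i b)
    (h2 : ∀ i a j, W i (P i a) j = ∑ k, (A' i a k * Y k j + A i a k * Y' k j) -
      ∑ b, open Classical in if b ∉ range (P i) ∧ P i a < b then c' i a b * G i b j else 0) :
    HasDerivAt (fun t : ℝ => param P (Y + t • Y') (A + t • A') (G + t • G') (0 + t • c')) W 0 := by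
  classical
  have hlin : ∀ a b : ℝ, HasDerivAt (fun t : ℝ => a + t * b) b 0 := fun a b => by
    simpa using ((hasDerivAt_id (0 : ℝ)).mul_const b).const_add a
  rw [hasDerivAt_pi]; intro i
  rw [hasDerivAt_pi]; intro b
  rw [hasDerivAt_pi]; intro j
  by_cases hb : b ∈ range (P i)
  · obtain ⟨a, rfl⟩ := hb
    simp only [param_apply, h2]
    refine HasDerivAt.sub (HasDerivAt.fun_sum fun k _ => ?_) (HasDerivAt.fun_sum fun b _ => ?_)
    · simpa using (hlin (A i a k) (A' i a k)).fun_mul (hlin (Y k j) (Y' k j))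
    · split_ifs
      · simpa using (hlin 0 (c' i a b)).fun_mul (hlin (G i b j) (G' i b j))
      · exact hasDerivAt_const _ _
  · simp only [param_apply' _ _ _ _ _ _ hb, h1 i b hb]
    exact hlin _ _

lemma thick_of_extZero (P : Fin 3 → Fin s ↪o Fin n) (hn : s + N = n) {x : Frames s} (hx : Indep x)
    {u : Frames N} (hu : Indep u) (h : ExtZero (fun i a => (P i a : ℕ) - a) x u) : Thick P := by
  classical
  subst hn
  choose q hq hlt using fun i => exists_compl_emb (P i) rfl
  have hqP : ∀ i m, q i m ∉ range (P i) := fun i m => by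
    have : q i m ∈ range (q i) := ⟨m, rfl⟩
    rw [hq] at this
    exact this
  have hinv : ∀ i, IsUnit (Matrix.of (u i)) := fun i =>
    Matrix.linearIndependent_rows_iff_isUnit.1 (hu i)
  set Y : Fin s → Fin (s + N) → ℝ := fun k => Fin.append (Pi.single k 1) 0 with hY
  set G : Frames (s + N) := fun i => Function.extend (q i)
    (fun m => Fin.append 0 fun j => (Matrix.of (u i))⁻¹ j m) 0 with hG
  let f : (Fin s → Fin (s + N) → ℝ) × Frames s × Frames (s + N) × (Fin 3 → Fin s → Fin (s + N) → ℝ) →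
      Frames (s + N) := fun z => param P z.1 z.2.1 z.2.2.1 z.2.2.2
  have hf : ContDiff ℝ ω f := contDiff_param P (by fun_prop) (by fun_prop) (by fun_prop)
    (by fun_prop)
  have hst : HasStrictFDerivAt f (fderiv ℝ f (Y, x, G, 0)) (Y, x, G, 0) :=
    hf.contDiffAt.hasStrictFDerivAt (by simp)
  have hsurj : (fderiv ℝ f (Y, x, G, 0)).range = ⊤ := by
    rw [LinearMap.range_eq_top]
    intro W
    obtain ⟨φ, hφ⟩ := h fun i a b => u i b ⬝ᵥ fun j => W i (P i a) (Fin.natAdd s j)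
    let Y' : Fin s → Fin (s + N) → ℝ := fun k => Fin.append 0 (φ (Pi.single k 1))
    let A' : Frames s := fun i a k => W i (P i a) (Fin.castAdd N k)
    let c' : Fin 3 → Fin s → Fin (s + N) → ℝ := fun i a => Function.extend (q i)
      (fun m => - (u i m ⬝ᵥ ((fun j => W i (P i a) (Fin.natAdd s j)) - φ (x i a)))) 0
    refine ⟨(Y', A', W, c'), ?_⟩
    have hd := hasDerivAt_param P Y Y' x A' G W c' (W := W) (fun _ _ _ => rfl) ?_
    · have hl : HasDerivAt (fun t : ℝ => (Y, x, G, (0 : Fin 3 → Fin s → Fin (s + N) → ℝ)) +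
          t • (Y', A', W, c')) (Y', A', W, c') 0 := by
        simpa using ((hasDerivAt_id (0 : ℝ)).smul_const (Y', A', W, c')).const_add
          (Y, x, G, (0 : Fin 3 → Fin s → Fin (s + N) → ℝ))
      have hst' : HasFDerivAt f (fderiv ℝ f (Y, x, G, 0))
          ((Y, x, G, (0 : Fin 3 → Fin s → Fin (s + N) → ℝ)) + (0 : ℝ) • (Y', A', W, c')) := by
        simpa using hst.hasFDerivAt
      have hcomp := hst'.comp_hasDerivAt (0 : ℝ) hl
      exact hcomp.unique hd
    · intro i a j
      have hsum : (∑ b, if b ∉ range (P i) ∧ P i a < b then c' i a b * G i b j else 0) =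
          ∑ m, if P i a < q i m then c' i a (q i m) * G i (q i m) j else 0 := by
        symm
        refine Fintype.sum_of_injective (q i) (q i).injective _ _ (fun b hb => ?_) fun m => ?_
        · rw [hq] at hb
          rw [if_neg fun h => hb h.1]
        · simp only [hqP i m, not_false_eq_true, true_and]
      rw [hsum]
      refine Fin.addCases (fun k => ?_) (fun l => ?_) j
      · have : ∀ m, G i (q i m) (Fin.castAdd N k) = 0 := fun m => by
          simp [hG, (q i).injective.extend_apply]
        simp [this, hY, A', Y', Pi.single_apply]
      · have hx1 : ∑ k, x i a k * φ (Pi.single k 1) l = φ (x i a) l := by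
          conv_rhs => rw [pi_eq_sum_univ' (x i a)]
          simp only [map_sum, Finset.sum_apply]
          refine Finset.sum_congr rfl fun k _ => ?_
          rw [map_smul]
          rfl
        set w : Fin N → ℝ := (fun j => W i (P i a) (Fin.natAdd s j)) - φ (x i a) with hw
        have hG' : ∀ m, G i (q i m) (Fin.natAdd s l) = (Matrix.of (u i))⁻¹ l m := fun m => by
          simp [hG, (q i).injective.extend_apply]
        have hc' : ∀ m, c' i a (q i m) = - (u i m ⬝ᵥ w) := fun m => by
          simp only [c', (q i).injective.extend_apply, hw]
        have hz : ∀ m, ¬ P i a < q i m → u i m ⬝ᵥ w = 0 := by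
          intro m hm
          rw [hlt] at hm
          rw [hw, dotProduct_sub, hφ i a m (by dsimp only; omega), sub_self]
        have hsum2 : (∑ m, if P i a < q i m then c' i a (q i m) * G i (q i m) (Fin.natAdd s l) else 0)
            = - w l := by
          have : w l = ((Matrix.of (u i))⁻¹.mulVec ((Matrix.of (u i)).mulVec w)) l := by
            rw [Matrix.mulVec_mulVec, Matrix.nonsing_inv_mul _
              ((Matrix.isUnit_iff_isUnit_det _).1 (hinv i)), Matrix.one_mulVec]
          rw [this, Matrix.mulVec, dotProduct, ← Finset.sum_neg_distrib]
          refine Finset.sum_congr rfl fun m _ => ?_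
          have hmv : (Matrix.of (u i)).mulVec w m = u i m ⬝ᵥ w := rfl
          split_ifs with h
          · rw [hG', hc', hmv]; ring
          · rw [hmv, hz m h]; ring
        rw [hsum2]
        simp [hY, Y', hx1, hw]
  intro hthin
  have hnhds := hst.map_nhds_eq_of_surj hsurj
  have hmem : {v : Frames (s + N) | HasSub v P} ∈ 𝓝 (f (Y, x, G, 0)) := by
    rw [← hnhds, mem_map]
    have hop : IsOpen {z : (Fin s → Fin (s + N) → ℝ) × Frames s × Frames (s + N) ×
        (Fin 3 → Fin s → Fin (s + N) → ℝ) | Indep z.2.1} :=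
      isOpen_indep.preimage (f := fun z : (Fin s → Fin (s + N) → ℝ) × Frames s × Frames (s + N) ×
        (Fin 3 → Fin s → Fin (s + N) → ℝ) => z.2.1) (by fun_prop)
    filter_upwards [hop.mem_nhds (show Indep x from hx)] with z hz
    exact hasSub_param P _ hz _ _
  obtain ⟨X, hX, hXo, hXm⟩ := mem_nhds_iff.1 hmem
  exact not_thin_of_open hXo ⟨_, hXm⟩ hX hthin

end Extension

section Rank

variable {V Q P : Type*} [NormedAddCommGroup V] [NormedSpace ℝ V] [FiniteDimensional ℝ V]
  [NormedAddCommGroup Q] [NormedSpace ℝ Q] [NormedAddCommGroup P]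

lemma card_le_finrank_range {m : Type*} [Fintype m] {f : V →L[ℝ] Q} {w : m → Q}
    (hw : LinearIndependent ℝ w) (h : ∀ j, w j ∈ f.range) : Fintype.card m ≤ finrank ℝ f.range := by
  have h1 : LinearIndependent ℝ fun j => (⟨w j, h j⟩ : f.range) :=
    LinearIndependent.of_comp f.range.subtype hw
  exact h1.fintype_card_le_finrank

lemma exists_linearIndependent_image (f : V →L[ℝ] Q) :
    ∃ x : Fin (finrank ℝ f.range) → V, LinearIndependent ℝ (fun j => f (x j)) ∧
      Submodule.span ℝ (range fun j => f (x j)) = f.range := by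
  have b := finBasis ℝ f.range
  choose x hx using fun j => (b j).2
  have he : (fun j => f (x j)) = f.range.subtype ∘ b := by
    funext j
    exact hx j
  refine ⟨x, ?_, ?_⟩
  · rw [he]
    exact b.linearIndependent.map' f.range.subtype (Submodule.ker_subtype _)
  · rw [he, range_comp, Submodule.span_image, b.span_eq, Submodule.map_top,
      Submodule.range_subtype]

lemma eventually_finrank_range_le {T : P → V →L[ℝ] Q} {p₀ : P} (hT : ContinuousAt T p₀) :
    ∀ᶠ p in 𝓝 p₀, finrank ℝ (T p₀).range ≤ finrank ℝ (T p).range := by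
  obtain ⟨x, hx, -⟩ := exists_linearIndependent_image (T p₀)
  have hc : ContinuousAt (fun p j => T p (x j)) p₀ := by
    rw [continuousAt_pi]
    intro j
    exact hT.clm_apply continuousAt_const
  filter_upwards [hc.eventually_mem (isOpen_setOfPred_linearIndependent.mem_nhds hx)] with p hp
  have := card_le_finrank_range hp fun j => ⟨x j, rfl⟩
  simpa using this

lemma deriv_mem_range_of_finrank_le {T : ℝ → V →L[ℝ] Q} {T' : V →L[ℝ] Q}
    (hT : HasDerivAt T T' 0)
    (hr : ∀ᶠ e in 𝓝 (0 : ℝ), finrank ℝ (T e).range ≤ finrank ℝ (T 0).range)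
    {x : V} (hx : T 0 x = 0) : T' x ∈ (T 0).range := by
  obtain ⟨z, hz, hspan⟩ := exists_linearIndependent_image (T 0)
  by_contra hc
  have hli : LinearIndependent ℝ fun o : Option (Fin (finrank ℝ (T 0).range)) =>
      Option.elim o (T' x) fun j => T 0 (z j) := by
    rw [linearIndependent_option]
    refine ⟨hz, ?_⟩
    have : ((fun o : Option (Fin (finrank ℝ (T 0).range)) =>
      Option.elim o (T' x) fun j => T 0 (z j)) ∘ some) = fun j => T 0 (z j) := rfl
    rw [this, hspan]
    exact hc
  have hslope : Tendsto (fun e : ℝ => e⁻¹ • T e x) (𝓝[≠] 0) (𝓝 (T' x)) := by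
    have h1 : HasDerivAt (fun e => T e x) (T' x) 0 := by
      simpa using hT.clm_apply (hasDerivAt_const (0 : ℝ) x)
    have h2 := h1.tendsto_slope_zero
    simpa [hx] using h2
  have hlim : Tendsto (fun (e : ℝ) (o : Option (Fin (finrank ℝ (T 0).range))) =>
      Option.elim o (e⁻¹ • T e x) fun j => T e (z j)) (𝓝[≠] 0)
      (𝓝 fun o => Option.elim o (T' x) fun j => T 0 (z j)) := by
    rw [tendsto_pi_nhds]
    rintro (_ | j)
    · exact hslope
    · have : ContinuousAt (fun e => T e (z j)) 0 := hT.continuousAt.clm_apply continuousAt_const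
      exact this.tendsto.mono_left nhdsWithin_le_nhds
  have hev := (hlim.eventually_mem (isOpen_setOfPred_linearIndependent.mem_nhds hli)).and
    (hr.filter_mono nhdsWithin_le_nhds)
  obtain ⟨e, he, hle⟩ := hev.exists
  have := card_le_finrank_range (f := T e) he (by
    rintro (_ | j)
    · exact ⟨e⁻¹ • x, by simp⟩
    · exact ⟨z j, rfl⟩)
  simp at this
  omega

variable [FiniteDimensional ℝ Q]

lemma exists_generalized_inverse (f : V →L[ℝ] Q) : ∃ g : Q →L[ℝ] V, ∀ x, f (g (f x)) = f x := by
  obtain ⟨g, hg⟩ := LinearMap.exists_rightInverse_of_surjective (f : V →ₗ[ℝ] Q).rangeRestrict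
    (LinearMap.range_rangeRestrict _)
  obtain ⟨π, hπ⟩ := LinearMap.exists_leftInverse_of_injective
    (f : V →ₗ[ℝ] Q).range.subtype (Submodule.ker_subtype _)
  refine ⟨LinearMap.toContinuousLinearMap (g ∘ₗ π), fun x => ?_⟩
  have h1 : π (f x) = (f : V →ₗ[ℝ] Q).rangeRestrict x :=
    LinearMap.congr_fun hπ ((f : V →ₗ[ℝ] Q).rangeRestrict x)
  have h2 := congrArg Subtype.val (LinearMap.congr_fun hg ((f : V →ₗ[ℝ] Q).rangeRestrict x))
  simpa [h1] using h2

lemma exists_ker_path [NormedSpace ℝ P] {L : P → V →L[ℝ] Q} {p₀ : P} (hL : DifferentiableAt ℝ L p₀)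
    (hr : ∀ᶠ p in 𝓝 p₀, finrank ℝ (L p).range ≤ finrank ℝ (L p₀).range) {φ : V}
    (hφ : L p₀ φ = 0) :
    ∃ ψ : P → V, DifferentiableAt ℝ ψ p₀ ∧ ψ p₀ = φ ∧ ∀ᶠ p in 𝓝 p₀, L p (ψ p) = 0 := by
  obtain ⟨g, hg⟩ := exists_generalized_inverse (L p₀)
  set G : Q →L[ℝ] V := g.comp ((L p₀).comp g) with hGdef
  have hG1 : ∀ x, L p₀ (G (L p₀ x)) = L p₀ x := fun x => by simp [hGdef, hg]
  have hG2 : ∀ y, G (L p₀ (G y)) = G y := fun y => by simp [hGdef, hg]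
  let B : P → V →L[ℝ] V := fun p => G.comp (L p) + 1 - G.comp (L p₀)
  have hB0 : B p₀ = 1 := by simp [B]
  have hBd : DifferentiableAt ℝ B p₀ :=
    (((differentiableAt_const G).clm_comp hL).add (differentiableAt_const _)).sub
      (differentiableAt_const _)
  have hinv : ∀ᶠ p in 𝓝 p₀, IsUnit (B p) := by
    have : {b : V →L[ℝ] V | IsUnit b} ∈ 𝓝 (B p₀) :=
      Units.isOpen.mem_nhds (by rw [hB0]; exact isUnit_one)
    exact hBd.continuousAt this
  have hGB : ∀ p x, G (L p x) = G (L p₀ (B p x)) := fun p x => by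
    simp [B, hG2, hG1]
  refine ⟨fun p => Ring.inverse (B p) φ, ?_, ?_, ?_⟩
  · have h1 : DifferentiableAt ℝ (fun p => Ring.inverse (B p)) p₀ := by
      have h2 : DifferentiableAt ℝ (Ring.inverse : (V →L[ℝ] V) → V →L[ℝ] V) (B p₀) := by
        rw [hB0]
        exact differentiableAt_inverse (𝕜 := ℝ) isUnit_one
      exact h2.comp p₀ hBd
    exact h1.clm_apply (differentiableAt_const φ)
  · simp [hB0]
  · filter_upwards [hinv, hr] with p hp hrp
    have hBφ : B p (Ring.inverse (B p) φ) = φ := by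
      have := Ring.mul_inverse_cancel (B p) hp
      exact congrArg (fun b : V →L[ℝ] V => b φ) this
    have h0 : G (L p (Ring.inverse (B p) φ)) = 0 := by
      rw [hGB, hBφ, hφ, map_zero]
    have hsurj : ∀ y, ∃ x, B p x = y := fun y =>
      ⟨Ring.inverse (B p) y, congrArg (fun b : V →L[ℝ] V => b y) (Ring.mul_inverse_cancel (B p) hp)⟩
    have hmap : finrank ℝ ((L p).range.map (G : Q →ₗ[ℝ] V)) = finrank ℝ (L p).range := by
      refine le_antisymm (Submodule.finrank_map_le _ _) (hrp.trans ?_)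
      have : (L p₀).range = ((L p).range.map (G : Q →ₗ[ℝ] V)).map (L p₀ : V →ₗ[ℝ] Q) := by
        ext z
        constructor
        · rintro ⟨x, rfl⟩
          obtain ⟨x', rfl⟩ := hsurj x
          refine ⟨_, ⟨_, ⟨x', rfl⟩, rfl⟩, ?_⟩
          change L p₀ (G (L p x')) = L p₀ (B p x')
          rw [hGB, hG1]
        · rintro ⟨_, -, rfl⟩
          exact ⟨_, rfl⟩
      rw [this]
      exact Submodule.finrank_map_le _ _
    have hinj : Function.Injective ((G : Q →ₗ[ℝ] V).domRestrict (L p).range) := by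
      rw [← LinearMap.ker_eq_bot]
      have h := LinearMap.finrank_range_add_finrank_ker ((G : Q →ₗ[ℝ] V).domRestrict (L p).range)
      rw [LinearMap.range_domRestrict, hmap] at h
      exact Submodule.finrank_eq_zero.1 (by omega)
    have := @hinj ⟨L p (Ring.inverse (B p) φ), ⟨_, rfl⟩⟩ 0 (by
      simpa using h0)
    exact congrArg Subtype.val this

end Rank

section Solvability

variable {r s N : ℕ}

/-- The subspace cut out by the first `t` functionals of the `i`-th family. -/
def annihilator (u : Frames N) (i : Fin 3) (t : ℕ) : Submodule ℝ (Fin N → ℝ) where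
  carrier := {w | ∀ b : Fin N, b.val < t → u i b ⬝ᵥ w = 0}
  add_mem' := fun hw hw' b hb => by rw [dotProduct_add, hw b hb, hw' b hb, add_zero]
  zero_mem' := fun b _ => dotProduct_zero _
  smul_mem' := fun c w hw b hb => by rw [dotProduct_smul, hw b hb, smul_zero]

lemma finrank_range_le_of_ker_le {H T T' : Type*} [AddCommGroup H] [Module ℝ H]
    [FiniteDimensional ℝ H] [AddCommGroup T] [Module ℝ T] [AddCommGroup T'] [Module ℝ T']
    {f : H →ₗ[ℝ] T} {g : H →ₗ[ℝ] T'} (h : LinearMap.ker f ≤ LinearMap.ker g) :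
    finrank ℝ (LinearMap.range g) ≤ finrank ℝ (LinearMap.range f) := by
  have h1 := LinearMap.finrank_range_add_finrank_ker f
  have h2 := LinearMap.finrank_range_add_finrank_ker g
  have h3 := Submodule.finrank_mono h
  omega

/-- Reduction of linear maps modulo subspaces, evaluated at a family of vectors. -/
def evalMod {V Q ι : Type*} [AddCommGroup V] [Module ℝ V] [AddCommGroup Q] [Module ℝ Q]
    (x : ι → V) (M : ι → Submodule ℝ Q) : (V →ₗ[ℝ] Q) →ₗ[ℝ] ((a : ι) → Q ⧸ M a) :=
  LinearMap.pi fun a => (M a).mkQ ∘ₗ LinearMap.applyₗ (x a)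

lemma evalMod_apply {V Q ι : Type*} [AddCommGroup V] [Module ℝ V] [AddCommGroup Q] [Module ℝ Q]
    (x : ι → V) (M : ι → Submodule ℝ Q) (φ : V →ₗ[ℝ] Q) (a : ι) :
    evalMod x M φ a = (M a).mkQ (φ (x a)) := rfl

lemma ExtZero.sum_finrank_le {y : Fin 3 → Fin s → ℕ} {x : Frames s} {u : Frames N}
    (h : ExtZero y x u) (M : Submodule ℝ (Fin N → ℝ)) :
    ∑ z : Fin 3 × Fin s, finrank ℝ ((Fin N → ℝ) ⧸ (M ⊔ annihilator u z.1 (y z.1 z.2))) ≤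
      s * finrank ℝ ((Fin N → ℝ) ⧸ M) := by
  classical
  set f := evalMod (fun z : Fin 3 × Fin s => x z.1 z.2)
    fun z => M ⊔ annihilator u z.1 (y z.1 z.2) with hf
  set g := evalMod (fun a : Fin s => (Pi.single a 1 : Fin s → ℝ)) fun _ => M with hg
  have hsurj : LinearMap.range f = ⊤ := by
    rw [LinearMap.range_eq_top]
    intro w
    choose w' hw' using fun z => Submodule.mkQ_surjective _ (w z)
    obtain ⟨φ, hφ⟩ := h fun i a b => u i b ⬝ᵥ w' (i, a)
    refine ⟨φ, funext fun z => ?_⟩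
    rw [hf, evalMod_apply, ← hw', Submodule.mkQ_apply, Submodule.mkQ_apply, Submodule.Quotient.eq]
    refine Submodule.mem_sup_right fun b hb => ?_
    rw [dotProduct_sub, hφ _ _ _ hb, sub_self]
  have hker : LinearMap.ker g ≤ LinearMap.ker f := by
    intro φ hφ
    rw [LinearMap.mem_ker] at hφ ⊢
    have h1 : ∀ a, φ (Pi.single a 1) ∈ M := fun a => by
      have := congrFun hφ a
      rwa [hg, evalMod_apply, Pi.zero_apply, Submodule.mkQ_apply,
        Submodule.Quotient.mk_eq_zero] at this
    have h2 : ∀ w, φ w ∈ M := fun w => by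
      rw [pi_eq_sum_univ' w, map_sum]
      refine Submodule.sum_mem _ fun a _ => ?_
      rw [map_smul]
      exact Submodule.smul_mem _ _ (h1 a)
    funext z
    rw [hf, evalMod_apply, Pi.zero_apply, Submodule.mkQ_apply, Submodule.Quotient.mk_eq_zero]
    exact Submodule.mem_sup_left (h2 _)
  have h1 := finrank_range_le_of_ker_le hker
  rw [hsurj, finrank_top, Module.finrank_pi_fintype] at h1
  refine h1.trans ((Submodule.finrank_le _).trans ?_)
  rw [Module.finrank_pi_fintype]
  simp

lemma exists_dotProduct_eq {w : Fin N → Fin N → ℝ} (hw : LinearIndependent ℝ w) (c : Fin N → ℝ) :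
    ∃ z, ∀ b, w b ⬝ᵥ z = c b := by
  have h : IsUnit (Matrix.of w) := Matrix.linearIndependent_rows_iff_isUnit.1 hw
  refine ⟨(Matrix.of w)⁻¹.mulVec c, fun b => ?_⟩
  have := congrFun (Matrix.mulVec_mulVec c (Matrix.of w) (Matrix.of w)⁻¹) b
  rw [Matrix.mul_nonsing_inv _ ((Matrix.isUnit_iff_isUnit_det _).1 h), Matrix.one_mulVec] at this
  exact this

/-- The basis given by one of the families. -/
noncomputable def Indep.basis {v : Frames r} (hv : Indep v) (i : Fin 3) :
    Basis (Fin r) ℝ (Fin r → ℝ) :=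
  Basis.mk (hv i) ((hv i).span_eq_top_of_card_eq_finrank' (by simp)).ge

lemma Indep.coe_basis {v : Frames r} (hv : Indep v) (i : Fin 3) : ⇑(hv.basis i) = v i :=
  Basis.coe_mk _ _

/-- `ψ` maps the kernel of `φ` to its range. -/
def Tangent {V Q : Type*} [AddCommGroup V] [Module ℝ V] [AddCommGroup Q] [Module ℝ Q]
    (φ ψ : V →ₗ[ℝ] Q) : Prop :=
  ∀ z, φ z = 0 → ψ z ∈ LinearMap.range φ

/-- `φ` satisfies the homogeneous conditions belonging to the `i`-th flags. -/
def Solves (y : Fin 3 → Fin r → ℕ) (v : Frames r) (u : Frames N) (i : Fin 3)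
    (φ : (Fin r → ℝ) →ₗ[ℝ] (Fin N → ℝ)) : Prop :=
  ∀ a, ∀ b : Fin N, b.val < y i a → u i b ⬝ᵥ φ (v i a) = 0

lemma Solves.sub {y : Fin 3 → Fin r → ℕ} {v : Frames r} {u : Frames N} {i : Fin 3}
    {φ ψ : (Fin r → ℝ) →ₗ[ℝ] (Fin N → ℝ)} (hφ : Solves y v u i φ) (hψ : Solves y v u i ψ) :
    Solves y v u i (φ - ψ) := fun a b hb => by
  rw [LinearMap.sub_apply, dotProduct_sub, hφ a b hb, hψ a b hb, sub_self]

lemma exists_solves {y : Fin 3 → Fin r → ℕ} {v : Frames r} (hv : Indep v) {u : Frames N}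
    {i : Fin 3} {p : Fin s ↪o Fin r} {x : Fin s → Fin r → ℝ} (hx : Echelon (v i) p x)
    {M : Submodule ℝ (Fin N → ℝ)} {ψ : (Fin r → ℝ) →ₗ[ℝ] (Fin N → ℝ)}
    (hψ : ∀ a, ψ (x a) ∈ M ⊔ annihilator u i (y i (p a))) :
    ∃ g, Solves y v u i g ∧ ∀ z ∈ Submodule.span ℝ (range x), (ψ - g) z ∈ M := by
  have hx' : Echelon (hv.basis i) p x := by rwa [hv.coe_basis]
  obtain ⟨B, hB1, hB2⟩ := hx'.exists_basis
  rw [hv.coe_basis] at hB2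
  choose m hm w hw hmw using fun a => Submodule.mem_sup.1 (hψ a)
  set g : (Fin r → ℝ) →ₗ[ℝ] (Fin N → ℝ) := B.constr ℝ (Function.extend p w 0) with hg
  have hg1 : ∀ a, g (x a) = w a := fun a => by
    rw [← hB1, hg, Basis.constr_basis, p.injective.extend_apply]
  have hg2 : ∀ b ∉ range p, g (v i b) = 0 := fun b hb => by
    rw [← hB2 b hb, hg, Basis.constr_basis, Function.extend_apply' _ _ _ (by simpa using hb)]
    rfl
  have hg3 : ∀ a, g (v i (p a)) = w a := fun a => by
    have : Submodule.span ℝ (v i '' {b | b ∉ range p ∧ p a < b}) ≤ LinearMap.ker g := by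
      rw [Submodule.span_le]
      rintro _ ⟨b, hb, rfl⟩
      exact hg2 b hb.1
    have h := this (hx a)
    rw [LinearMap.mem_ker, map_sub, hg1, sub_eq_zero] at h
    exact h
  refine ⟨g, fun a b hb => ?_, fun z hz => ?_⟩
  · by_cases ha : a ∈ range p
    · obtain ⟨a, rfl⟩ := ha
      rw [hg3]
      exact hw a b hb
    · rw [hg2 a ha, dotProduct_zero]
  · have : Submodule.span ℝ (range x) ≤ M.comap (ψ - g) := by
      rw [Submodule.span_le]
      rintro _ ⟨a, rfl⟩
      rw [SetLike.mem_coe, Submodule.mem_comap, LinearMap.sub_apply, hg1, ← hmw,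
        add_sub_cancel_right]
      exact hm a
    exact this hz

lemma extZero_of_tangent {y : Fin 3 → Fin r → ℕ} {v : Frames r} (hv : Indep v) {u : Frames N}
    (hu : Indep u) {φ : (Fin r → ℝ) →ₗ[ℝ] (Fin N → ℝ)} {p : Fin 3 → Fin s ↪o Fin r}
    {x : Fin 3 → Fin s → Fin r → ℝ} (hx : ∀ i, Echelon (v i) (p i) (x i))
    (hspan : ∀ i, Submodule.span ℝ (range (x i)) = LinearMap.ker φ)
    (hker : ∀ ψ, (∀ i, Solves y v u i ψ) → Tangent φ ψ)
    (hdef : ∀ Z : Fin 3 → (Fin r → ℝ) →ₗ[ℝ] (Fin N → ℝ), (∀ i, Tangent φ (Z i)) →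
      ∃ φ', Tangent φ φ' ∧ ∀ i, Solves y v u i (φ' - Z i))
    (hcount : ∑ z : Fin 3 × Fin s, finrank ℝ ((Fin N → ℝ) ⧸
        (LinearMap.range φ ⊔ annihilator u z.1 (y z.1 (p z.1 z.2)))) ≤
      s * finrank ℝ ((Fin N → ℝ) ⧸ LinearMap.range φ)) :
    ExtZero y v u := by
  classical
  set f := evalMod (fun z : Fin 3 × Fin s => x z.1 z.2)
    fun z => LinearMap.range φ ⊔ annihilator u z.1 (y z.1 (p z.1 z.2)) with hf
  set g := evalMod (fun a : Fin s => x 0 a) fun _ => LinearMap.range φ with hg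
  have hT : ∀ ψ, (∀ i a, ψ (x i a) ∈ LinearMap.range φ ⊔ annihilator u i (y i (p i a))) →
      ∃ φ', Tangent φ φ' ∧ ∀ i, Solves y v u i (ψ - φ') := by
    intro ψ hψ
    choose k hk1 hk2 using fun i => exists_solves hv (hx i) (hψ i)
    obtain ⟨φ', h1, h2⟩ := hdef (fun i => ψ - k i) fun i z hz =>
      hk2 i z (by rw [hspan]; exact hz)
    refine ⟨φ', h1, fun i => ?_⟩
    convert (hk1 i).sub (h2 i) using 1
    abel
  have hle : LinearMap.ker f ≤ LinearMap.ker g := by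
    intro ψ hψ
    rw [LinearMap.mem_ker] at hψ ⊢
    obtain ⟨φ', h1, h2⟩ := hT ψ fun i a => by
      have := congrFun hψ (i, a)
      rwa [hf, evalMod_apply, Pi.zero_apply, Submodule.mkQ_apply,
        Submodule.Quotient.mk_eq_zero] at this
    have h3 := hker _ h2
    funext a
    rw [hg, evalMod_apply, Pi.zero_apply, Submodule.mkQ_apply, Submodule.Quotient.mk_eq_zero]
    have hxa : φ (x 0 a) = 0 := by
      rw [← LinearMap.mem_ker, ← hspan 0]
      exact Submodule.subset_span ⟨a, rfl⟩
    have := add_mem (h3 _ hxa) (h1 _ hxa)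
    rwa [LinearMap.sub_apply, sub_add_cancel] at this
  have hgs : LinearMap.range g = ⊤ := by
    rw [LinearMap.range_eq_top]
    intro w
    have hx' : Echelon (hv.basis 0) (p 0) (x 0) := by rw [hv.coe_basis]; exact hx 0
    obtain ⟨B, hB1, -⟩ := hx'.exists_basis
    choose w' hw' using fun a => Submodule.mkQ_surjective _ (w a)
    refine ⟨B.constr ℝ (Function.extend (p 0) w' 0), funext fun a => ?_⟩
    rw [hg, evalMod_apply, ← hB1, Basis.constr_basis, (p 0).injective.extend_apply, hw']
  have h1 := finrank_range_le_of_ker_le hle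
  have hfs : LinearMap.range f = ⊤ := by
    refine Submodule.eq_top_of_finrank_eq (le_antisymm (Submodule.finrank_le _) ?_)
    rw [hgs, finrank_top, Module.finrank_pi_fintype] at h1
    rw [Module.finrank_pi_fintype]
    refine hcount.trans (le_trans (le_of_eq ?_) h1)
    simp
  rw [LinearMap.range_eq_top] at hfs
  intro c
  choose w hw using fun i a => exists_dotProduct_eq (hu i) (c i a)
  set h : Fin 3 → (Fin r → ℝ) →ₗ[ℝ] (Fin N → ℝ) := fun i => (hv.basis i).constr ℝ (w i) with hh
  have hhv : ∀ i a, h i (v i a) = w i a := fun i a => by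
    rw [← hv.coe_basis i, hh]
    exact Basis.constr_basis _ _ _ _
  obtain ⟨ψ, hψ⟩ := hfs fun z => Submodule.mkQ _ (h z.1 (x z.1 z.2))
  have hψ' : ∀ i a, (ψ - h i) (x i a) ∈ LinearMap.range φ ⊔ annihilator u i (y i (p i a)) := by
    intro i a
    have := congrFun hψ (i, a)
    rwa [hf, evalMod_apply, Submodule.mkQ_apply, Submodule.mkQ_apply,
      Submodule.Quotient.eq] at this
  choose k hk1 hk2 using fun i => exists_solves hv (hx i) (hψ' i)
  obtain ⟨φ', -, h2⟩ := hdef (fun i => ψ - h i - k i) fun i z hz =>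
    hk2 i z (by rw [hspan]; exact hz)
  refine ⟨ψ - φ', fun i a b hb => ?_⟩
  have h3 := (hk1 i).sub (h2 i) a b hb
  have h4 : k i - (φ' - (ψ - h i - k i)) = (ψ - φ') - h i := by abel
  rw [h4, LinearMap.sub_apply, dotProduct_sub, hhv, hw, sub_eq_zero] at h3
  exact h3

end Solvability

section Deformation

variable {r s N : ℕ}

/-- The index set of the conditions in `ExtZero`. -/
abbrev Cond (N : ℕ) (y : Fin 3 → Fin r → ℕ) : Type :=
  {z : Fin 3 × Fin r × Fin N // z.2.2.val < y z.1 z.2.1}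

/-- The linear map whose surjectivity is `ExtZero`. -/
noncomputable def condMap (y : Fin 3 → Fin r → ℕ) (p : Frames r × Frames N) :
    ((Fin r → ℝ) →L[ℝ] (Fin N → ℝ)) →L[ℝ] (Cond N y → ℝ) :=
  LinearMap.toContinuousLinearMap
    { toFun := fun φ z => p.2 z.1.1 z.1.2.2 ⬝ᵥ φ (p.1 z.1.1 z.1.2.1)
      map_add' := fun φ ψ => funext fun z => dotProduct_add _ _ _
      map_smul' := fun c φ => funext fun z => by simp [dotProduct_smul] }

lemma condMap_apply (y : Fin 3 → Fin r → ℕ) (p : Frames r × Frames N)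
    (φ : (Fin r → ℝ) →L[ℝ] (Fin N → ℝ)) (z : Cond N y) :
    condMap y p φ z = p.2 z.1.1 z.1.2.2 ⬝ᵥ φ (p.1 z.1.1 z.1.2.1) := rfl

lemma condMap_eq_zero {y : Fin 3 → Fin r → ℕ} {p : Frames r × Frames N}
    {φ : (Fin r → ℝ) →L[ℝ] (Fin N → ℝ)} :
    condMap y p φ = 0 ↔ ∀ i, Solves y p.1 p.2 i φ :=
  ⟨fun h i a b hb => congrFun h ⟨(i, a, b), hb⟩, fun h => funext fun z => h _ _ _ z.2⟩

lemma contDiff_condMap (y : Fin 3 → Fin r → ℕ) :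
    ContDiff ℝ ω (condMap (N := N) y) := by
  rw [contDiff_clm_apply_iff]
  intro φ
  rw [contDiff_pi]
  intro z
  simp only [condMap_apply, dotProduct]
  fun_prop

lemma extZero_iff {y : Fin 3 → Fin r → ℕ} {p : Frames r × Frames N} :
    ExtZero y p.1 p.2 ↔ Function.Surjective (condMap y p) := by
  constructor
  · intro h c
    obtain ⟨φ, hφ⟩ := h fun i a b => if hb : b.val < y i a then c ⟨(i, a, b), hb⟩ else 0
    refine ⟨LinearMap.toContinuousLinearMap φ, funext fun z => ?_⟩
    have := hφ z.1.1 z.1.2.1 z.1.2.2 z.2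
    rw [dif_pos z.2] at this
    exact this
  · intro h c
    obtain ⟨φ, hφ⟩ := h fun z => c z.1.1 z.1.2.1 z.1.2.2
    exact ⟨φ, fun i a b hb => congrFun hφ ⟨(i, a, b), hb⟩⟩

lemma thin_not_extZero {y : Fin 3 → Fin r → ℕ} {v : Frames r} {u : Frames N}
    (h : ExtZero y v u) : Thin {p : Frames r × Frames N | ¬ ExtZero y p.1 p.2} := by
  have h1 := thin_not_surjective (fun p : Frames r × Frames N =>
    (condMap y p : ((Fin r → ℝ) →L[ℝ] (Fin N → ℝ)) →ₗ[ℝ] (Cond N y → ℝ)))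
    (fun φ => (contDiff_condMap y).clm_apply contDiff_const) (v, u)
    ((extZero_iff (p := (v, u))).1 h)
  exact h1.mono fun p hp hs => hp (extZero_iff.2 hs)

lemma thin_not_extZero_right {y : Fin 3 → Fin r → ℕ} {v : Frames r} {u : Frames N}
    (h : ExtZero y v u) : Thin {u : Frames N | ¬ ExtZero y v u} := by
  have h1 := thin_not_surjective (fun u : Frames N =>
    (condMap y (v, u) : ((Fin r → ℝ) →L[ℝ] (Fin N → ℝ)) →ₗ[ℝ] (Cond N y → ℝ)))
    (fun φ => ((contDiff_condMap y).comp (by fun_prop)).clm_apply contDiff_const) u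
    ((extZero_iff (p := (v, u))).1 h)
  exact h1.mono fun u' hp hs => hp ((extZero_iff (p := (v, u'))).2 hs)

lemma tangent_of_solves {y : Fin 3 → Fin r → ℕ} {p : Frames r × Frames N}
    {φ : (Fin r → ℝ) →L[ℝ] (Fin N → ℝ)} (hφ : ∀ i, Solves y p.1 p.2 i φ)
    (hmax : ∀ ψ : (Fin r → ℝ) →L[ℝ] (Fin N → ℝ), (∀ i, Solves y p.1 p.2 i ψ) →
      finrank ℝ ψ.range ≤ finrank ℝ φ.range)
    (ψ : (Fin r → ℝ) →ₗ[ℝ] (Fin N → ℝ)) (hψ : ∀ i, Solves y p.1 p.2 i ψ) :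
    Tangent (φ : (Fin r → ℝ) →ₗ[ℝ] (Fin N → ℝ)) ψ := by
  intro z hz
  set ψ' := LinearMap.toContinuousLinearMap ψ with hψ'
  have hd : HasDerivAt (fun e : ℝ => φ + e • ψ') ψ' 0 := by
    simpa using ((hasDerivAt_id (0 : ℝ)).smul_const ψ').const_add φ
  have := deriv_mem_range_of_finrank_le hd (Eventually.of_forall fun e => ?_) (x := z)
    (by simpa using hz)
  · simpa [hψ'] using this
  · have h0 : φ + (0 : ℝ) • ψ' = φ := by simp
    rw [h0]
    refine hmax _ fun i a b hb => ?_
    have h1 := hφ i a b hb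
    have h2 := hψ i a b hb
    simp only [ContinuousLinearMap.coe_coe] at h1 ⊢
    rw [add_apply, smul_apply, dotProduct_add,
      dotProduct_smul, h1, hψ', LinearMap.coe_toContinuousLinearMap', h2]
    simp

lemma Tangent.exists_eq {φ : (Fin r → ℝ) →L[ℝ] (Fin N → ℝ)}
    {Z : (Fin r → ℝ) →ₗ[ℝ] (Fin N → ℝ)}
    (h : Tangent (φ : (Fin r → ℝ) →ₗ[ℝ] (Fin N → ℝ)) Z) :
    ∃ (X : (Fin r → ℝ) →ₗ[ℝ] (Fin r → ℝ)) (Y : (Fin N → ℝ) →ₗ[ℝ] (Fin N → ℝ)),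
      ∀ w, Z w = Y (φ w) + φ (X w) := by
  obtain ⟨g, hg⟩ := exists_generalized_inverse φ
  refine ⟨(g : (Fin N → ℝ) →ₗ[ℝ] (Fin r → ℝ)) ∘ₗ Z,
    (Z - (φ : (Fin r → ℝ) →ₗ[ℝ] (Fin N → ℝ)) ∘ₗ
      (g : (Fin N → ℝ) →ₗ[ℝ] (Fin r → ℝ)) ∘ₗ Z) ∘ₗ (g : (Fin N → ℝ) →ₗ[ℝ] (Fin r → ℝ)),
    fun w => ?_⟩
  have h1 : ∀ z, φ z = 0 → Z z - φ (g (Z z)) = 0 := by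
    intro z hz
    obtain ⟨x, hx⟩ := h z hz
    change φ x = Z z at hx
    rw [← hx, hg, sub_self]
  have h2 := h1 (w - g (φ w)) (by rw [map_sub, hg, sub_self])
  simp only [map_sub] at h2
  simp only [LinearMap.comp_apply, LinearMap.sub_apply, ContinuousLinearMap.coe_coe]
  rw [← sub_eq_zero, ← h2]
  abel

lemma exists_tangent_of_max {y : Fin 3 → Fin r → ℕ} {p : Frames r × Frames N}
    {φ : (Fin r → ℝ) →L[ℝ] (Fin N → ℝ)} (hφ : ∀ i, Solves y p.1 p.2 i φ)
    (hr : ∀ᶠ p' in 𝓝 p, finrank ℝ (condMap y p').range ≤ finrank ℝ (condMap y p).range)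
    (hmax : ∀ᶠ p' in 𝓝 p, ∀ ψ : (Fin r → ℝ) →L[ℝ] (Fin N → ℝ), (∀ i, Solves y p'.1 p'.2 i ψ) →
      finrank ℝ ψ.range ≤ finrank ℝ φ.range)
    (Z : Fin 3 → (Fin r → ℝ) →ₗ[ℝ] (Fin N → ℝ))
    (hZ : ∀ i, Tangent (φ : (Fin r → ℝ) →ₗ[ℝ] (Fin N → ℝ)) (Z i)) :
    ∃ φ', Tangent (φ : (Fin r → ℝ) →ₗ[ℝ] (Fin N → ℝ)) φ' ∧
      ∀ i, Solves y p.1 p.2 i (φ' - Z i) := by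
  obtain ⟨ψ, hψd, hψ0, hψ⟩ := exists_ker_path
    ((contDiff_condMap y).contDiffAt.differentiableAt (by simp)) hr (condMap_eq_zero.2 hφ)
  have hXY : ∀ i, ∃ (X : (Fin r → ℝ) →ₗ[ℝ] (Fin r → ℝ)) (Y : (Fin N → ℝ) →ₗ[ℝ] (Fin N → ℝ)),
      ∀ w, (-Z i) w = Y (φ w) + φ (X w) := fun i =>
    Tangent.exists_eq fun z hz => by
      rw [LinearMap.neg_apply]
      exact neg_mem (hZ i z hz)
  choose X Y hXY using hXY
  let v' : Frames r := fun i a => X i (p.1 i a)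
  let u' : Frames N := fun i b => Matrix.vecMul (p.2 i b) (LinearMap.toMatrix' (Y i))
  have hu' : ∀ i b w, u' i b ⬝ᵥ w = p.2 i b ⬝ᵥ Y i w := fun i b w => by
    simp only [u']
    rw [← Matrix.dotProduct_mulVec, LinearMap.toMatrix'_mulVec]
  have hc : HasDerivAt (fun e : ℝ => p + e • (v', u')) (v', u') 0 := by
    simpa using ((hasDerivAt_id (0 : ℝ)).smul_const (v', u')).const_add p
  have hc0 : p + (0 : ℝ) • (v', u') = p := by simp
  have hψd' : HasFDerivAt ψ (fderiv ℝ ψ p) (p + (0 : ℝ) • (v', u')) := by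
    rw [hc0]; exact hψd.hasFDerivAt
  set χ : ℝ → (Fin r → ℝ) →L[ℝ] (Fin N → ℝ) := fun e => ψ (p + e • (v', u')) with hχ
  set χ' : (Fin r → ℝ) →L[ℝ] (Fin N → ℝ) := fderiv ℝ ψ p (v', u') with hχ'
  have hχd : HasDerivAt χ χ' 0 := hψd'.comp_hasDerivAt (0 : ℝ) hc
  have hχ0 : χ 0 = φ := by
    change ψ (p + (0 : ℝ) • (v', u')) = φ
    rw [hc0, hψ0]
  have htend : Tendsto (fun e : ℝ => p + e • (v', u')) (𝓝 0) (𝓝 p) := by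
    have := hc.continuousAt.tendsto
    rwa [hc0] at this
  have hsol : ∀ᶠ e in 𝓝 (0 : ℝ), ∀ i,
      Solves y (p + e • (v', u')).1 (p + e • (v', u')).2 i (χ e) :=
    (htend.eventually hψ).mono fun e he => condMap_eq_zero.1 he
  refine ⟨χ', fun z hz => ?_, fun i a b hb => ?_⟩
  · have h1 : ∀ᶠ e in 𝓝 (0 : ℝ), finrank ℝ (χ e).range ≤ finrank ℝ (χ 0).range := by
      filter_upwards [htend.eventually hmax, hsol] with e he1 he2
      rw [hχ0]
      exact he1 _ he2
    have := deriv_mem_range_of_finrank_le hχd h1 (x := z) (by rw [hχ0]; exact hz)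
    rwa [hχ0] at this
  · have hw : HasDerivAt (fun e : ℝ => p.1 i a + e • v' i a) (v' i a) 0 := by
      simpa using ((hasDerivAt_id (0 : ℝ)).smul_const (v' i a)).const_add (p.1 i a)
    have hu : HasDerivAt (fun e : ℝ => p.2 i b + e • u' i b) (u' i b) 0 := by
      simpa using ((hasDerivAt_id (0 : ℝ)).smul_const (u' i b)).const_add (p.2 i b)
    have hF : HasDerivAt
        (fun e : ℝ => (p.2 i b + e • u' i b) ⬝ᵥ χ e (p.1 i a + e • v' i a))
        (u' i b ⬝ᵥ φ (p.1 i a) + p.2 i b ⬝ᵥ (χ' (p.1 i a) + φ (v' i a))) 0 := by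
      have h1 := hχd.clm_apply hw
      simp only [dotProduct, ← Finset.sum_add_distrib]
      refine HasDerivAt.fun_sum fun j _ => ?_
      have h2 := (hasDerivAt_pi.1 hu j).fun_mul (hasDerivAt_pi.1 h1 j)
      simpa [hχ0] using h2
    have hF0 : HasDerivAt
        (fun e : ℝ => (p.2 i b + e • u' i b) ⬝ᵥ χ e (p.1 i a + e • v' i a)) 0 0 :=
      (hasDerivAt_const (0 : ℝ) (0 : ℝ)).congr_of_eventuallyEq
        (hsol.mono fun e he => he i a b hb)
    have h3 := hF.unique hF0
    have h4 := hXY i (p.1 i a)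
    rw [LinearMap.neg_apply] at h4
    rw [LinearMap.sub_apply, sub_eq_add_neg, h4, dotProduct_add, dotProduct_add, ← hu']
    rw [dotProduct_add] at h3
    rw [← h3]
    simp only [ContinuousLinearMap.coe_coe, v']
    ring

end Deformation

section Existence

variable {r N : ℕ}

lemma exists_forall_le_of_bounded {α : Type*} {S : Set α} (hS : S.Nonempty) (f : α → ℕ) (B : ℕ)
    (hB : ∀ a, f a ≤ B) : ∃ a ∈ S, ∀ b ∈ S, f b ≤ f a := by
  obtain ⟨_, ⟨a, ha, rfl⟩, h⟩ := Nat.sSup_mem (hS.image f) ⟨B, by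
    rintro _ ⟨a, -, rfl⟩
    exact hB a⟩ |> fun h => (⟨_, h, fun b hb => le_csSup ⟨B, by
      rintro _ ⟨a, -, rfl⟩
      exact hB a⟩ hb⟩ : ∃ m ∈ f '' S, ∀ b ∈ f '' S, b ≤ m)
  exact ⟨a, ha, fun b hb => h _ ⟨b, hb, rfl⟩⟩

lemma thick_refl : Thick fun _ : Fin 3 => (RelEmbedding.refl _ : Fin r ↪o Fin r) := by
  obtain ⟨v, hv⟩ := exists_indep (n := r)
  refine not_thin_of_open isOpen_indep ⟨v, hv⟩ fun v (hv : Indep v) => ⟨v, fun i j => ?_, ?_⟩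
  · rw [(hv i).span_eq_top_of_card_eq_finrank' (by simp),
      (hv j).span_eq_top_of_card_eq_finrank' (by simp)]
  · intro i a
    change v i a - v i a ∈ _
    rw [sub_self]
    exact zero_mem _

lemma card_cond_le (y : Fin 3 → Fin r → ℕ) : Fintype.card (Cond N y) ≤ ∑ i, ∑ a, y i a := by
  have h : Fintype.card (Cond N y) ≤
      Fintype.card ((z : Σ _ : Fin 3, Fin r) × Fin (y z.1 z.2)) := by
    refine Fintype.card_le_of_injective (fun z => ⟨⟨z.1.1, z.1.2.1⟩, ⟨z.1.2.2.val, z.2⟩⟩) ?_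
    rintro ⟨⟨i, a, b⟩, hb⟩ ⟨⟨i', a', b'⟩, hb'⟩ h
    simp only [Sigma.mk.injEq] at h
    obtain ⟨⟨rfl, h1⟩, h2⟩ := h
    obtain rfl := eq_of_heq h1
    have := congrArg Fin.val (eq_of_heq h2)
    simp only at this
    rw [Subtype.mk.injEq, Prod.mk.injEq, Prod.mk.injEq]
    exact ⟨rfl, rfl, Fin.ext this⟩
  rw [Fintype.card_sigma] at h
  simp only [Fintype.card_fin] at h
  rwa [Fintype.sum_sigma] at h

/-- The configurations at which some solution of the homogeneous system has maximal rank. -/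
lemma exists_maximal_rank (y : Fin 3 → Fin r → ℕ) :
    ∃ m, ¬ Thin {p : Frames r × Frames N | Indep p.1 ∧ Indep p.2 ∧
      (∀ᶠ p' in 𝓝 p, finrank ℝ (condMap y p').range ≤ finrank ℝ (condMap y p).range) ∧
      (∀ᶠ p' in 𝓝 p, ∀ ψ : (Fin r → ℝ) →L[ℝ] (Fin N → ℝ), (∀ i, Solves y p'.1 p'.2 i ψ) →
        finrank ℝ ψ.range ≤ m) ∧
      ∃ φ : (Fin r → ℝ) →L[ℝ] (Fin N → ℝ), (∀ i, Solves y p.1 p.2 i φ) ∧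
        finrank ℝ φ.range = m} := by
  set I : Set (Frames r × Frames N) := {p | Indep p.1 ∧ Indep p.2} with hI
  have hIo : IsOpen I :=
    (isOpen_indep.preimage continuous_fst).inter (isOpen_indep.preimage continuous_snd)
  have hIne : I.Nonempty := by
    obtain ⟨v, hv⟩ := exists_indep (n := r)
    obtain ⟨u, hu⟩ := exists_indep (n := N)
    exact ⟨(v, u), hv, hu⟩
  obtain ⟨p₀, hp₀, hmax₀⟩ := exists_forall_le_of_bounded hIne
    (fun p => finrank ℝ (condMap y p).range) (Fintype.card (Cond N y)) fun p => by
      simpa using Submodule.finrank_le (condMap y p).range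
  set J : Set (Frames r × Frames N) :=
    {p | p ∈ I ∧ ∀ q ∈ I, finrank ℝ (condMap y q).range ≤ finrank ℝ (condMap y p).range} with hJ
  have hJnhds : ∀ p ∈ J, J ∈ 𝓝 p := by
    intro p hp
    filter_upwards [hIo.mem_nhds hp.1,
      eventually_finrank_range_le (contDiff_condMap y).continuous.continuousAt] with q hq1 hq2
    exact ⟨hq1, fun q' hq' => (hp.2 q' hq').trans hq2⟩
  obtain ⟨⟨p₁, φ₁⟩, ⟨hp₁, hφ₁⟩, hmax₁⟩ := exists_forall_le_of_bounded
    (S := {z : (Frames r × Frames N) × ((Fin r → ℝ) →L[ℝ] (Fin N → ℝ)) |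
      z.1 ∈ J ∧ ∀ i, Solves y z.1.1 z.1.2 i z.2})
    ⟨(p₀, 0), ⟨hp₀, hmax₀⟩, fun i a b hb => by simp⟩
    (fun z => finrank ℝ z.2.range) N fun z => by simpa using Submodule.finrank_le z.2.range
  have hr : ∀ p ∈ J,
      ∀ᶠ p' in 𝓝 p, finrank ℝ (condMap y p').range ≤ finrank ℝ (condMap y p).range := by
    intro p hp
    filter_upwards [hIo.mem_nhds hp.1] with q hq using hp.2 q hq
  obtain ⟨ψ, hψd, hψ0, hψ⟩ := exists_ker_path
    ((contDiff_condMap y).contDiffAt.differentiableAt (by simp)) (hr _ hp₁)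
    (condMap_eq_zero.2 hφ₁)
  refine ⟨finrank ℝ φ₁.range, fun hthin => ?_⟩
  have hmem : ∀ᶠ p in 𝓝 p₁, p ∈ {p : Frames r × Frames N | Indep p.1 ∧ Indep p.2 ∧
      (∀ᶠ p' in 𝓝 p, finrank ℝ (condMap y p').range ≤ finrank ℝ (condMap y p).range) ∧
      (∀ᶠ p' in 𝓝 p, ∀ ψ : (Fin r → ℝ) →L[ℝ] (Fin N → ℝ), (∀ i, Solves y p'.1 p'.2 i ψ) →
        finrank ℝ ψ.range ≤ finrank ℝ φ₁.range) ∧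
      ∃ φ : (Fin r → ℝ) →L[ℝ] (Fin N → ℝ), (∀ i, Solves y p.1 p.2 i φ) ∧
        finrank ℝ φ.range = finrank ℝ φ₁.range} := by
    filter_upwards [hJnhds _ hp₁, hψ, eventually_finrank_range_le hψd.continuousAt]
      with p hp1 hp2 hp3
    rw [hψ0] at hp3
    have hs := condMap_eq_zero.1 hp2
    refine ⟨hp1.1.1, hp1.1.2, hr p hp1, ?_, ψ p, hs, le_antisymm (hmax₁ (p, ψ p) ⟨hp1, hs⟩) hp3⟩
    filter_upwards [hJnhds _ hp1] with q hq ψ' hψ'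
    exact hmax₁ (q, ψ') ⟨hq, hψ'⟩
  exact not_thin_of_open isOpen_interior ⟨p₁, mem_interior_iff_mem_nhds.2 hmem⟩
    interior_subset hthin

/-- The configurations for which some subspace has prescribed position with respect to the flags
of annihilators. -/
def HasPosition (y : Fin 3 → Fin r → ℕ) (d : ℕ) (ρ : Fin 3 → Fin r → ℕ) (u : Frames N) : Prop :=
  ∃ M : Submodule ℝ (Fin N → ℝ), finrank ℝ ((Fin N → ℝ) ⧸ M) = d ∧
    ∀ i a, finrank ℝ ((Fin N → ℝ) ⧸ (M ⊔ annihilator u i (y i a))) = ρ i a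

theorem exists_extZero (y : Fin 3 → Fin r → ℕ)
    (h : ∀ (s : ℕ) (P : Fin 3 → Fin s ↪o Fin r), Thick P → ∑ i, ∑ a, y i (P i a) ≤ s * N) :
    ∃ (v : Frames r) (u : Frames N), Indep v ∧ Indep u ∧ ExtZero y v u := by
  induction r using Nat.strong_induction_on with
  | _ r ih =>
  obtain ⟨m, hX⟩ := exists_maximal_rank (N := N) y
  have hfin : ∀ s : ℕ, Finite (Fin s ↪o Fin r) := fun s => DFunLike.finite _
  let D : (Σ s : Fin (r + 1), Fin 3 → Fin s ↪o Fin r) ⊕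
      (Fin (N + 1) × (Fin 3 → Fin r → Fin (N + 1))) → Set (Frames r × Frames N) :=
    Sum.elim (fun τ => {p | HasSub p.1 τ.2})
      fun ρ => {p | HasPosition y ρ.1 (fun i a => ρ.2 i a) p.2}
  obtain ⟨p, ⟨hv, hu, hr, hmax, φ, hφ, rfl⟩, hgen⟩ := exists_generic D hX
  refine ⟨p.1, p.2, hv, hu, ?_⟩
  have hthick : ∀ (s : ℕ), s ≤ r → ∀ τ : Fin 3 → Fin s ↪o Fin r, HasSub p.1 τ → Thick τ := by
    intro s hs τ hτ hthin
    exact hgen (.inl ⟨⟨s, by omega⟩, τ⟩) hτ (hthin.preimage contDiff_fst Prod.fst_surjective)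
  by_cases hm : φ = 0
  · have hinj : Function.Injective (condMap y p) := by
      rw [injective_iff_map_eq_zero]
      intro ψ hψ
      have h1 := hmax.self_of_nhds ψ (condMap_eq_zero.1 hψ)
      rw [hm] at h1
      have h0 : (0 : (Fin r → ℝ) →L[ℝ] (Fin N → ℝ)).range = ⊥ := LinearMap.range_zero
      have h2 : finrank ℝ ψ.range = 0 := by
        rw [h0, finrank_bot] at h1
        omega
      have h3 := Submodule.finrank_eq_zero.1 h2
      ext1 z
      have : ψ z ∈ ψ.range := ⟨z, rfl⟩
      rw [h3] at this
      simpa using this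
    have h1 := h r _ thick_refl
    have h2 := (card_cond_le (N := N) y).trans h1
    rw [extZero_iff]
    have h3 : finrank ℝ ((Fin r → ℝ) →L[ℝ] (Fin N → ℝ)) = r * N := by
      rw [← (LinearMap.toContinuousLinearMap :
        ((Fin r → ℝ) →ₗ[ℝ] (Fin N → ℝ)) ≃ₗ[ℝ] _).finrank_eq, Module.finrank_linearMap]
      simp
    have h4 : finrank ℝ (Cond N y → ℝ) = Fintype.card (Cond N y) := by simp
    have h5 := LinearMap.finrank_le_finrank_of_injective
      (f := (condMap y p : ((Fin r → ℝ) →L[ℝ] (Fin N → ℝ)) →ₗ[ℝ] (Cond N y → ℝ))) hinj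
    exact (LinearMap.injective_iff_surjective_of_finrank_eq_finrank (by omega)
      (f := (condMap y p : ((Fin r → ℝ) →L[ℝ] (Fin N → ℝ)) →ₗ[ℝ] (Cond N y → ℝ)))).1 hinj
  · obtain ⟨s, hs⟩ : ∃ s, finrank ℝ (LinearMap.ker (φ : (Fin r → ℝ) →ₗ[ℝ] (Fin N → ℝ))) = s :=
      ⟨_, rfl⟩
    have hsr : s < r := by
      have h1 : LinearMap.ker (φ : (Fin r → ℝ) →ₗ[ℝ] (Fin N → ℝ)) < ⊤ := by
        rw [lt_top_iff_ne_top]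
        intro htop
        apply hm
        ext1 z
        have : z ∈ LinearMap.ker (φ : (Fin r → ℝ) →ₗ[ℝ] (Fin N → ℝ)) := htop ▸ trivial
        simpa using this
      have := Submodule.finrank_lt h1.ne
      simpa [hs] using this
    choose τ x hspan hx using fun i => exists_echelon (hv.basis i) _ hs
    simp only [hv.coe_basis] at hx
    have hτ : Thick τ := hthick s hsr.le τ ⟨x, fun i j => by rw [hspan, hspan], hx⟩
    obtain ⟨A, u₀, -, -, hA⟩ := ih s hsr (fun i a => y i (τ i a)) fun t P hP =>
      h t (fun i => (P i).trans (τ i)) (hτ.comp hP)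
    have hle : ∀ M : Submodule ℝ (Fin N → ℝ), finrank ℝ ((Fin N → ℝ) ⧸ M) < N + 1 := fun M => by
      have := Submodule.finrank_quotient_le M
      simp at this
      omega
    set M := LinearMap.range (φ : (Fin r → ℝ) →ₗ[ℝ] (Fin N → ℝ)) with hM
    have hR := hgen (.inr ⟨⟨_, hle M⟩, fun i a => ⟨_, hle (M ⊔ annihilator p.2 i (y i a))⟩⟩)
      ⟨M, rfl, fun i a => rfl⟩
    obtain ⟨q, ⟨M', hq1, hq2⟩, hq3⟩ : ∃ q : Frames r × Frames N,
        HasPosition y (finrank ℝ ((Fin N → ℝ) ⧸ M))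
          (fun i a => finrank ℝ ((Fin N → ℝ) ⧸ (M ⊔ annihilator p.2 i (y i a)))) q.2 ∧
        ExtZero (fun i a => y i (τ i a)) A q.2 := by
      by_contra! hc
      exact hR (((thin_not_extZero_right hA).preimage contDiff_snd Prod.snd_surjective).mono
        fun q hq => hc q hq)
    refine extZero_of_tangent hv hu (φ := φ) hx hspan
      (tangent_of_solves hφ hmax.self_of_nhds) (exists_tangent_of_max hφ hr hmax) ?_
    have h1 := hq3.sum_finrank_le M'
    simp only [hq1, hq2] at h1
    exact h1

end Existence

section Thickness

variable {n r s t : ℕ}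

lemma emb_le (p : Fin s ↪o Fin n) : s ≤ n := by
  simpa using Fintype.card_le_of_injective p p.injective

/-- To bound a weight on all thick positions it suffices to bound it on those which satisfy the
numerical condition of `exists_extremal`. -/
lemma sum_weight_le_of_thick (κ : Fin 3 → Fin r → ℕ) (hκ : ∀ i, StrictMono (κ i))
    (ϖ : Fin 3 → ℕ → ℕ) (hϖ : ∀ i, Monotone (ϖ i)) (σ : Equiv.Perm (Fin 3))
    (hσ : ∀ i, ϖ (σ i) = ϖ i) (N : ℕ)
    (h : ∀ (s : ℕ) (P : Fin 3 → Fin s ↪o Fin r), Thick P →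
      s * (r - s) ≤ ∑ i, (Finset.univ.filter fun z : Fin s × Fin r =>
        z.2 ∉ range (P i) ∧ κ i z.2 < κ (σ i) (P (σ i) z.1)).card →
      ∑ i, ∑ a, ϖ i (κ i (P i a)) ≤ s * N)
    (P : Fin 3 → Fin s ↪o Fin r) (hP : Thick P) : ∑ i, ∑ a, ϖ i (κ i (P i a)) ≤ s * N := by
  have hfin : ∀ s : ℕ, Finite (Fin s ↪o Fin r) := fun s => DFunLike.finite _
  let D : Option (Σ s : Fin (r + 1), Fin 3 → Fin s ↪o Fin r) → Set (Frames r) :=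
    fun o => o.elim {v | ¬ Indep v} fun τ => {v | HasSub v τ.2}
  obtain ⟨v, ⟨x, hx, hE⟩, hgen⟩ := exists_generic D hP
  have hv : Indep v := by
    by_contra hc
    exact hgen none hc thin_not_indep
  obtain ⟨s', P', x', hx', hE', hmax, hcard⟩ := exists_extremal hv.basis κ hκ ϖ hϖ σ hσ N
  simp only [hv.coe_basis] at hE' hmax
  have h1 := hmax s P x hx hE
  have h2 := h s' P' (hgen (some ⟨⟨s', by have := emb_le (P' 0); omega⟩, P'⟩) ⟨x', hx', hE'⟩) hcard
  zify at h2 ⊢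
  linarith

lemma sum_card_compl_lt (P : Fin s ↪o Fin r)
    [DecidablePred fun z : Fin s × Fin r => z.2 ∉ range P ∧ z.2 < P z.1] :
    (Finset.univ.filter fun z : Fin s × Fin r => z.2 ∉ range P ∧ z.2 < P z.1).card =
      ∑ a, ((P a : ℕ) - a) := by
  classical
  rw [Finset.card_filter, Fintype.sum_prod_type]
  refine Finset.sum_congr rfl fun a _ => ?_
  rw [← Finset.card_filter, ← card_compl_lt P a, Nat.add_sub_cancel]
  congr!

lemma le_emb (p : Fin s ↪o Fin n) (a : Fin s) : (a : ℕ) ≤ p a := by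
  classical
  have := card_compl_lt p a
  omega

lemma edim_eq (P : Fin 3 → Fin s ↪o Fin n) :
    edim P = s * (n - s : ℕ) - ∑ i, ∑ a, ((P i a - a : ℕ) : ℤ) := by
  rw [edim, Nat.cast_sub (emb_le (P 0))]
  congr 1
  refine Finset.sum_congr rfl fun i _ => Finset.sum_congr rfl fun a _ => ?_
  rw [Nat.cast_sub (le_emb _ _)]

lemma edim_comp (p : Fin 3 → Fin s ↪o Fin n) (P : Fin 3 → Fin t ↪o Fin s) :
    edim (fun i => (P i).trans (p i)) =
      edim P + t * (n - s : ℕ) - ∑ i, ∑ a, ((p i (P i a) - P i a : ℕ) : ℤ) := by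
  rw [edim, edim, Nat.cast_sub (emb_le (p 0))]
  have : ∑ i, ∑ a, ((p i (P i a) - P i a : ℕ) : ℤ) =
      ∑ i, ∑ a, ((((P i).trans (p i) a : ℕ) : ℤ) - (a : ℕ)) -
        ∑ i, ∑ a, (((P i a : ℕ) : ℤ) - (a : ℕ)) := by
    simp only [← Finset.sum_sub_distrib]
    refine Finset.sum_congr rfl fun i _ => Finset.sum_congr rfl fun a _ => ?_
    rw [Nat.cast_sub (le_emb _ _), RelEmbedding.trans_apply]
    ring
  rw [this]
  ring

lemma Thick.sum_le {p : Fin 3 → Fin s ↪o Fin n} (hp : Thick p) {P : Fin 3 → Fin t ↪o Fin s}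
    (hP : Thick P) (h0 : edim P = 0) : ∑ i, ∑ a, ((p i (P i a) : ℕ) - P i a) ≤ t * (n - s) := by
  have h1 := (hp.comp hP).edim_nonneg
  rw [edim_comp, h0] at h1
  zify
  linarith

lemma sum_le_of_edim_eq_zero (p : Fin 3 → Fin s ↪o Fin n) (N : ℕ)
    (h : ∀ (t : ℕ) (P : Fin 3 → Fin t ↪o Fin s), Thick P → edim P = 0 →
      ∑ i, ∑ a, ((p i (P i a) : ℕ) - P i a) ≤ t * N)
    (P : Fin 3 → Fin t ↪o Fin s) (hP : Thick P) :
    ∑ i, ∑ a, ((p i (P i a) : ℕ) - P i a) ≤ t * N := by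
  classical
  let ϖ : Fin 3 → ℕ → ℕ := fun i m =>
    (Finset.univ.filter fun b => b ∉ range (p i) ∧ (b : ℕ) < m).card
  have hϖ' : ∀ i a, ϖ i (p i a) = (p i a : ℕ) - a := fun i a => by
    have := card_compl_lt (p i) a
    simp only [Fin.lt_def] at this
    simp only [ϖ]
    omega
  have := sum_weight_le_of_thick (fun i a => (p i a : ℕ)) (fun i => (p i).strictMono) ϖ
    (fun i m m' hm => Finset.card_le_card fun b hb => by
      rw [Finset.mem_filter_univ] at hb ⊢
      exact ⟨hb.1, hb.2.trans_le hm⟩)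
    (Equiv.refl _) (fun i => rfl) N (fun t P hP hc => ?_) P hP
  · simpa only [hϖ'] using this
  · simp only [hϖ']
    refine h t P hP (le_antisymm ?_ hP.edim_nonneg)
    simp only [Equiv.refl_apply, ← Fin.lt_def, OrderEmbedding.lt_iff_lt, sum_card_compl_lt] at hc
    rw [edim_eq]
    zify at hc
    linarith

lemma thick_of_forall_edim_nonneg (p : Fin 3 → Fin s ↪o Fin n) (hp : edim p = 0)
    (h : ∀ t, 1 ≤ t → t < s → ∀ P : Fin 3 → Fin t ↪o Fin s, Thick P → edim P = 0 →
      0 ≤ edim fun i => (P i).trans (p i)) : Thick p := by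
  have key : ∀ (t : ℕ) (P : Fin 3 → Fin t ↪o Fin s), Thick P → edim P = 0 →
      ∑ i, ∑ a, ((p i (P i a) : ℕ) - P i a) ≤ t * (n - s) := by
    intro t P hP hP0
    rcases Nat.eq_zero_or_pos t with rfl | ht
    · simp
    rcases (emb_le (P 0)).lt_or_eq with hts | rfl
    · have h1 := h t ht hts P hP hP0
      rw [edim_comp, hP0] at h1
      zify
      linarith
    · have hid : ∀ i a, P i a = a := fun i a => by
        classical
        have h1 := card_compl_gt (P i) a
        have h2 := le_emb (P i) a
        exact Fin.ext (by omega)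
      simp only [hid]
      rw [edim_eq] at hp
      zify
      linarith
  obtain ⟨v, u, hv, hu, hvu⟩ := exists_extZero (N := n - s) (fun i a => (p i a : ℕ) - a)
    fun t P hP => sum_le_of_edim_eq_zero p (n - s) key P hP
  exact thick_of_extZero p (by have := emb_le (p 0); omega) hv hu hvu

end Thickness

section Translation

variable {n s t : ℕ}

/-- The image of a position vector, counted from `1`. -/
def up (p : Fin s ↪o Fin n) : Finset ℕ := Finset.univ.image fun a => (p a : ℕ) + 1

/-- The image of a position vector, counted backwards from `1`. -/
def down (p : Fin s ↪o Fin n) : Finset ℕ := Finset.univ.image fun a => n - (p a : ℕ)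

lemma nthElt_image {g : Fin s → ℕ} (hg : StrictMono g) (a : Fin s) :
    nthElt (Finset.univ.image g) (a + 1) = g a := by
  have hc : (Finset.univ.image g).card = s := by
    rw [Finset.card_image_of_injective _ hg.injective, Finset.card_fin]
  have h := Finset.orderEmbOfFin_unique hc (f := g)
    (fun x => Finset.mem_image_of_mem _ (Finset.mem_univ x)) hg
  have h2 := congrFun h a
  rw [Finset.orderEmbOfFin_apply] at h2
  rw [h2, nthElt, Nat.add_sub_cancel]
  have hl : (a : ℕ) < ((Finset.univ.image g).sort (· ≤ ·)).length := by simp [hc]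
  rw [List.getD_eq_getElem _ _ hl]
  rfl

lemma strictMono_up (p : Fin s ↪o Fin n) : StrictMono fun a => (p a : ℕ) + 1 :=
  fun a b h => by
    have : p a < p b := p.strictMono h
    simpa using this

lemma strictAnti_down (p : Fin s ↪o Fin n) : StrictAnti fun a => n - (p a : ℕ) :=
  fun a b h => by
    have : p a < p b := p.strictMono h
    simp only
    omega

lemma nthElt_up (p : Fin s ↪o Fin n) (a : Fin s) : nthElt (up p) (a + 1) = p a + 1 :=
  nthElt_image (strictMono_up p) a

lemma nthElt_down (p : Fin s ↪o Fin n) (a : Fin s) : nthElt (down p) (s - a) = n - p a := by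
  have h : down p = Finset.univ.image fun a : Fin s => n - (p a.rev : ℕ) := by
    ext m
    simp only [down, Finset.mem_image, Finset.mem_univ, true_and]
    exact ⟨fun ⟨a, ha⟩ => ⟨a.rev, by simpa using ha⟩, fun ⟨a, ha⟩ => ⟨a.rev, ha⟩⟩
  have h2 := nthElt_image (g := fun a : Fin s => n - (p a.rev : ℕ))
    (fun a b hab => strictAnti_down p (Fin.rev_lt_rev.2 hab)) a.rev
  rw [← h, Fin.rev_rev, Fin.val_rev] at h2
  rw [← h2]
  congr 1
  omega

lemma sum_up (p : Fin s ↪o Fin n) (f : ℕ → ℕ) : ∑ i ∈ up p, f i = ∑ a, f (p a + 1) :=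
  Finset.sum_image fun _ _ _ _ h => (strictMono_up p).injective h

lemma sum_down (p : Fin s ↪o Fin n) (f : ℕ → ℕ) : ∑ i ∈ down p, f i = ∑ a, f (n - p a) :=
  Finset.sum_image fun _ _ _ _ h => (strictAnti_down p).injective h

lemma card_up (p : Fin s ↪o Fin n) : (up p).card = s := by
  rw [up, Finset.card_image_of_injective _ (strictMono_up p).injective, Finset.card_fin]

lemma card_down (p : Fin s ↪o Fin n) : (down p).card = s := by
  rw [down, Finset.card_image_of_injective _ (strictAnti_down p).injective, Finset.card_fin]

lemma up_subset (p : Fin s ↪o Fin n) : up p ⊆ Finset.Icc 1 n := by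
  intro m hm
  obtain ⟨a, -, rfl⟩ := Finset.mem_image.1 hm
  simp only [Finset.mem_Icc]
  omega

lemma down_subset (p : Fin s ↪o Fin n) : down p ⊆ Finset.Icc 1 n := by
  intro m hm
  obtain ⟨a, -, rfl⟩ := Finset.mem_image.1 hm
  simp only [Finset.mem_Icc]
  omega

lemma exists_image_eq {g : Fin n → ℕ} (hg : Function.Injective g) {I : Finset ℕ}
    (hI : ∀ m ∈ I, ∃ b, g b = m) (hs : I.card = s) :
    ∃ p : Fin s ↪o Fin n, (Finset.univ.image fun a => g (p a)) = I := by
  set S := Finset.univ.filter fun b => g b ∈ I with hS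
  have h : S.image g = I := by
    ext m
    simp only [hS, Finset.mem_image, Finset.mem_filter_univ]
    refine ⟨fun ⟨b, hb, he⟩ => he ▸ hb, fun hm => ?_⟩
    obtain ⟨b, rfl⟩ := hI m hm
    exact ⟨b, hm, rfl⟩
  have hc : S.card = s := by rw [← hs, ← h, Finset.card_image_of_injective _ hg]
  refine ⟨S.orderEmbOfFin hc, ?_⟩
  rw [← Finset.coe_inj, Finset.coe_image, Finset.coe_univ, image_univ,
    ← Function.comp_def, range_comp, Finset.range_orderEmbOfFin, ← Finset.coe_image, h]

lemma exists_up_eq {I : Finset ℕ} (hI : I ⊆ Finset.Icc 1 n) (hs : I.card = s) :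
    ∃ p : Fin s ↪o Fin n, up p = I :=
  exists_image_eq (g := fun b : Fin n => (b : ℕ) + 1)
    (fun a b h => Fin.ext (by simpa using h)) (fun m hm => by
      have := Finset.mem_Icc.1 (hI hm)
      exact ⟨⟨m - 1, by omega⟩, Nat.sub_add_cancel this.1⟩) hs

lemma exists_down_eq {K : Finset ℕ} (hK : K ⊆ Finset.Icc 1 n) (hs : K.card = s) :
    ∃ p : Fin s ↪o Fin n, down p = K :=
  exists_image_eq (g := fun b : Fin n => n - (b : ℕ))
    (fun a b h => Fin.ext (by simp only at h; omega)) (fun m hm => by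
      have := Finset.mem_Icc.1 (hK hm)
      exact ⟨⟨n - m, by omega⟩, Nat.sub_sub_self this.2⟩) hs

lemma edim_eq_sum (p : Fin 3 → Fin s ↪o Fin n) :
    edim p = ((∑ a, (n - p 2 a : ℕ) + s * (s + 1) / 2 : ℕ) : ℤ) -
      ((∑ a, ((p 0 a : ℕ) + 1) + ∑ a, ((p 1 a : ℕ) + 1) : ℕ) : ℤ) := by
  have h1 : ((∑ a, (n - p 2 a : ℕ) : ℕ) : ℤ) = s * n - ∑ a, ((p 2 a : ℕ) : ℤ) := by
    push_cast
    rw [Finset.sum_congr rfl fun a _ => Nat.cast_sub (p 2 a).is_lt.le, Finset.sum_sub_distrib]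
    simp
  have h2 : ((s * (s + 1) / 2 : ℕ) : ℤ) = ∑ a : Fin s, ((a : ℕ) : ℤ) + s := by
    rw [← Nat.cast_sum, Fin.sum_univ_eq_sum_range (fun a => a), Finset.sum_range_id]
    have := Nat.triangle_succ s
    rw [Nat.add_sub_cancel, mul_comm] at this
    rw [this]
    push_cast
    rfl
  have h3 : (s : ℤ) * s = 2 * ∑ a : Fin s, ((a : ℕ) : ℤ) + s := by
    rw [← Nat.cast_sum, Fin.sum_univ_eq_sum_range (fun a => a), mul_comm 2]
    have := Finset.sum_range_id_mul_two s
    rcases s with _ | s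
    · simp
    · rw [Nat.add_sub_cancel] at this
      zify at this ⊢
      rw [this]
      ring
  rw [Nat.cast_add, h1, h2, edim, Fin.sum_univ_three]
  push_cast
  simp only [Finset.sum_sub_distrib, Finset.sum_add_distrib]
  simp
  linarith

lemma isU_iff (p : Fin 3 → Fin s ↪o Fin n) :
    IsU n s (up (p 0)) (up (p 1)) (down (p 2)) ↔ edim p = 0 := by
  rw [edim_eq_sum, sub_eq_zero, Nat.cast_inj]
  simp only [IsU, up_subset, down_subset, card_up, card_down, true_and, sum_up, sum_down]
  exact eq_comm

lemma exists_eq_of_isU {I J K : Finset ℕ} (h : IsU n s I J K) :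
    ∃ p : Fin 3 → Fin s ↪o Fin n, up (p 0) = I ∧ up (p 1) = J ∧ down (p 2) = K := by
  obtain ⟨hI, hJ, hK, hI', hJ', hK', -⟩ := h
  obtain ⟨p0, h0⟩ := exists_up_eq hI hI'
  obtain ⟨p1, h1⟩ := exists_up_eq hJ hJ'
  obtain ⟨p2, h2⟩ := exists_down_eq hK hK'
  exact ⟨![p0, p1, p2], h0, h1, h2⟩

lemma sum_nthElt_le_iff (p : Fin 3 → Fin s ↪o Fin n) (P : Fin 3 → Fin t ↪o Fin s) :
    ∑ f ∈ up (P 0), nthElt (up (p 0)) f + ∑ g ∈ up (P 1), nthElt (up (p 1)) g ≤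
        ∑ h ∈ down (P 2), nthElt (down (p 2)) h + t * (t + 1) / 2 ↔
      0 ≤ edim fun i => (P i).trans (p i) := by
  rw [edim_eq_sum, sub_nonneg, Nat.cast_le]
  simp only [sum_up, sum_down, nthElt_up, nthElt_down, RelEmbedding.trans_apply]

theorem isT_iff (p : Fin 3 → Fin s ↪o Fin n) :
    IsT n s (up (p 0)) (up (p 1)) (down (p 2)) ↔ Thick p ∧ edim p = 0 := by
  induction s using Nat.strong_induction_on generalizing n with
  | _ s ih =>
  rw [IsT, isU_iff, and_comm (b := edim p = 0)]
  refine and_congr_right fun h0 => ⟨fun h => ?_, fun h t ht hts F G H hFGH => ?_⟩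
  · refine thick_of_forall_edim_nonneg p h0 fun t ht hts P hP hP0 => ?_
    rw [← sum_nthElt_le_iff]
    exact h t ht hts _ _ _ ((ih t hts P).2 ⟨hP, hP0⟩)
  · have hU := hFGH
    rw [IsT] at hU
    obtain ⟨P, rfl, rfl, rfl⟩ := exists_eq_of_isU hU.1
    rw [sum_nthElt_le_iff]
    exact (h.comp ((ih t hts P).1 hFGH).1).edim_nonneg

end Translation

section Doubling

variable {n r s : ℕ}

@[simp]
lemma swap_two : Equiv.swap (0 : Fin 3) 1 2 = 2 := rfl

/-- The position of `p i a` in the doubled triple. -/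
def key (p : Fin 3 → Fin r ↪o Fin n) (i : Fin 3) (a : Fin r) : ℕ := 2 * p i a + ![0, 1, 0] i

/-- All positions in the `i`-th member of the doubled triple. -/
def doubled (p : Fin 3 → Fin r ↪o Fin n) (i : Fin 3) : Fin r ⊕ Fin r → Fin (2 * n) :=
  Sum.elim
    (fun a => ⟨2 * p i a + ![0, 1, 0] i, by
      have h : ![0, 1, 0] i < 2 := by fin_cases i <;> simp
      omega⟩)
    fun a => ⟨2 * p (Equiv.swap 0 1 i) a + ![1, 0, 1] i, by
      have h : ![1, 0, 1] i < 2 := by fin_cases i <;> simp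
      omega⟩

lemma doubled_inl (p : Fin 3 → Fin r ↪o Fin n) (i : Fin 3) (a : Fin r) :
    (doubled p i (.inl a) : ℕ) = key p i a := rfl

lemma strictMono_key (p : Fin 3 → Fin r ↪o Fin n) (i : Fin 3) : StrictMono (key p i) :=
  fun a b h => by
    have : p i a < p i b := (p i).strictMono h
    simp only [key]
    omega

lemma doubled_injective (p : Fin 3 → Fin r ↪o Fin n) (i : Fin 3) :
    Function.Injective (doubled p i) := by
  rintro (a | a) (b | b) h
  all_goals
    have h' := congrArg Fin.val h
    fin_cases i <;> simp [doubled] at h' ⊢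
  all_goals first
    | omega
    | exact (p _).injective (Fin.ext h')

lemma doubled_inr_lt_iff (p : Fin 3 → Fin r ↪o Fin n) (i : Fin 3) (a b : Fin r) :
    (doubled p i (.inr b) : ℕ) < key p i a ↔ key p (Equiv.swap 0 1 i) b < key p i a := by
  fin_cases i <;> simp [doubled, key, -OrderEmbedding.lt_iff_lt]
  omega

lemma range_doubled_swap (p : Fin 3 → Fin r ↪o Fin n) (i : Fin 3) :
    range (doubled p (Equiv.swap 0 1 i)) = range (doubled p i) := by
  fin_cases i
  · rw [← (Equiv.sumComm (Fin r) (Fin r)).surjective.range_comp]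
    congr 1
    funext z
    rcases z with a | a <;> simp [doubled]
  · rw [← (Equiv.sumComm (Fin r) (Fin r)).surjective.range_comp]
    congr 1
    funext z
    rcases z with a | a <;> simp [doubled]
  · rfl

open Classical in
/-- The number of gaps of the doubled triple below a given position. -/
noncomputable def gaps (p : Fin 3 → Fin r ↪o Fin n) (i : Fin 3) (m : ℕ) : ℕ :=
  (Finset.univ.filter fun b => b ∉ range (doubled p i) ∧ (b : ℕ) < m).card

lemma monotone_gaps (p : Fin 3 → Fin r ↪o Fin n) (i : Fin 3) : Monotone (gaps p i) :=
  fun m m' hm => Finset.card_le_card fun b hb => by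
    rw [Finset.mem_filter_univ] at hb ⊢
    exact ⟨hb.1, hb.2.trans_le hm⟩

lemma gaps_swap (p : Fin 3 → Fin r ↪o Fin n) (i : Fin 3) :
    gaps p (Equiv.swap 0 1 i) = gaps p i := by
  funext m
  simp only [gaps, range_doubled_swap]

lemma gaps_doubled_inr (p : Fin 3 → Fin r ↪o Fin n) (i : Fin 3) (a : Fin r) :
    gaps p i (doubled p i (.inr a)) =
      gaps p (Equiv.swap 0 1 i) (key p (Equiv.swap 0 1 i) a) := by
  rw [gaps_swap]
  fin_cases i
  · rfl
  · rfl
  · refine congrArg Finset.card (Finset.filter_congr fun b _ => and_congr_right fun hb => ?_)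
    have h : (b : ℕ) ≠ key p 2 a := fun h => hb ⟨.inl a, Fin.ext h.symm⟩
    simp [doubled, key] at h ⊢
    omega

lemma gaps_add (p : Fin 3 → Fin r ↪o Fin n) (i : Fin 3) (a : Fin r) :
    gaps p i (key p i a) + a +
      (Finset.univ.filter fun b => key p (Equiv.swap 0 1 i) b < key p i a).card = key p i a := by
  classical
  have h1 : (Finset.univ.filter fun b : Fin (2 * n) => (b : ℕ) < key p i a).card = key p i a := by
    rw [← doubled_inl, show (Finset.univ.filter fun b : Fin (2 * n) =>
      (b : ℕ) < doubled p i (.inl a)) = Finset.Iio (doubled p i (.inl a)) by ext; simp,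
      Fin.card_Iio]
  have h2 : (Finset.univ.filter fun b => b ∈ range (doubled p i) ∧ (b : ℕ) < key p i a) =
      (Finset.univ.filter fun z => (doubled p i z : ℕ) < key p i a).image (doubled p i) := by
    ext b
    simp only [Finset.mem_filter_univ, Finset.mem_image]
    constructor
    · rintro ⟨⟨z, rfl⟩, hz⟩
      exact ⟨z, hz, rfl⟩
    · rintro ⟨z, hz, rfl⟩
      exact ⟨⟨z, rfl⟩, hz⟩
  have h3 : (Finset.univ.filter fun z => (doubled p i z : ℕ) < key p i a).card = a +
      (Finset.univ.filter fun b => key p (Equiv.swap 0 1 i) b < key p i a).card := by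
    rw [Finset.card_filter, Fintype.sum_sum_type, ← Finset.card_filter, ← Finset.card_filter]
    simp only [doubled_inl, doubled_inr_lt_iff, (strictMono_key p i).lt_iff_lt]
    congr 1
    rw [show (Finset.univ.filter fun b => b < a) = Finset.Iio a by ext; simp, Fin.card_Iio]
  have h4 := Finset.card_filter_add_card_filter_not
    (s := Finset.univ.filter fun b : Fin (2 * n) => (b : ℕ) < key p i a)
    (fun b => b ∈ range (doubled p i))
  rw [Finset.filter_filter, Finset.filter_filter, h1] at h4
  simp only [and_comm (a := (_ : ℕ) < _)] at h4
  rw [h2, Finset.card_image_of_injective _ (doubled_injective p i), h3] at h4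
  rw [gaps]
  omega

lemma key_ne_key (p : Fin 3 → Fin r ↪o Fin n) (a b : Fin r) : key p 0 a ≠ key p 1 b := by
  simp [key]
  omega

lemma sum_gaps (p : Fin 3 → Fin r ↪o Fin n) (P : Fin 3 → Fin s ↪o Fin r)
    [∀ i, DecidablePred fun z : Fin s × Fin r => z.2 ∉ range (P i) ∧
      key p i z.2 < key p (Equiv.swap 0 1 i) (P (Equiv.swap 0 1 i) z.1)] :
    ∑ i, ∑ a, gaps p i (key p i (P i a)) + ∑ i, ∑ a, (P i a : ℕ) +
      ∑ i, (Finset.univ.filter fun z : Fin s × Fin r => z.2 ∉ range (P i) ∧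
        key p i z.2 < key p (Equiv.swap 0 1 i) (P (Equiv.swap 0 1 i) z.1)).card +
      s * s + ∑ a : Fin s, (a : ℕ) = 2 * ∑ i, ∑ a, (p i (P i a) : ℕ) + s := by
  classical
  have h1 : ∑ i, ∑ a, gaps p i (key p i (P i a)) + ∑ i, ∑ a, (P i a : ℕ) +
      ∑ i, ∑ a, (Finset.univ.filter fun b =>
        key p (Equiv.swap 0 1 i) b < key p i (P i a)).card =
      2 * ∑ i, ∑ a, (p i (P i a) : ℕ) + s := by
    simp only [← Finset.sum_add_distrib, gaps_add, Finset.mul_sum]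
    simp only [key, Finset.sum_add_distrib, Fin.sum_univ_three]
    simp
  have h2 : ∀ i, ∑ a, (Finset.univ.filter fun b =>
        key p (Equiv.swap 0 1 i) b < key p i (P i a)).card =
      (Finset.univ.filter fun z : Fin s × Fin r => z.2 ∉ range (P (Equiv.swap 0 1 i)) ∧
        key p (Equiv.swap 0 1 i) z.2 < key p i (P i z.1)).card +
      (Finset.univ.filter fun z : Fin s × Fin s =>
        key p (Equiv.swap 0 1 i) (P (Equiv.swap 0 1 i) z.2) < key p i (P i z.1)).card := by
    intro i
    rw [Finset.card_filter, Finset.card_filter, Fintype.sum_prod_type, Fintype.sum_prod_type,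
      ← Finset.sum_add_distrib]
    refine Finset.sum_congr rfl fun a _ => ?_
    rw [← Finset.card_filter, ← Finset.card_filter, ← Finset.card_map
      (P (Equiv.swap 0 1 i)).toEmbedding, ← Finset.card_union_of_disjoint]
    · congr 1
      ext b
      simp only [Finset.mem_filter_univ, Finset.mem_union, Finset.mem_map]
      by_cases hb : b ∈ range (P (Equiv.swap 0 1 i))
      · obtain ⟨c, rfl⟩ := hb
        simp
      · simp only [hb, not_false_iff, true_and]
        refine ⟨Or.inl, fun h => h.resolve_right ?_⟩
        rintro ⟨c, -, rfl⟩
        exact hb ⟨c, rfl⟩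
    · rw [Finset.disjoint_left]
      intro b hb hb'
      obtain ⟨c, -, rfl⟩ := Finset.mem_map.1 hb'
      exact (Finset.mem_filter_univ _ |>.1 hb).1 ⟨c, rfl⟩
  have h3 : ∑ i, (Finset.univ.filter fun z : Fin s × Fin r =>
        z.2 ∉ range (P (Equiv.swap 0 1 i)) ∧
          key p (Equiv.swap 0 1 i) z.2 < key p i (P i z.1)).card =
      ∑ i, (Finset.univ.filter fun z : Fin s × Fin r => z.2 ∉ range (P i) ∧
        key p i z.2 < key p (Equiv.swap 0 1 i) (P (Equiv.swap 0 1 i) z.1)).card := by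
    rw [← Equiv.sum_comp (Equiv.swap (0 : Fin 3) 1)]
    refine Finset.sum_congr rfl fun i _ => ?_
    congr! <;> simp
  have h4 : ∑ i, (Finset.univ.filter fun z : Fin s × Fin s =>
        key p (Equiv.swap 0 1 i) (P (Equiv.swap 0 1 i) z.2) < key p i (P i z.1)).card =
      s * s + ∑ a : Fin s, (a : ℕ) := by
    rw [Fin.sum_univ_three]
    have e0 : Equiv.swap (0 : Fin 3) 1 0 = 1 := rfl
    have e1 : Equiv.swap (0 : Fin 3) 1 1 = 0 := rfl
    rw [e0, e1, swap_two]
    congr 1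
    · have := Finset.card_filter_add_card_filter_not (s := (Finset.univ : Finset (Fin s × Fin s)))
        (fun z => key p 1 (P 1 z.2) < key p 0 (P 0 z.1))
      rw [Finset.card_univ, Fintype.card_prod, Fintype.card_fin] at this
      rw [← this]
      congr 1
      rw [← Finset.card_map (Equiv.prodComm (Fin s) (Fin s)).toEmbedding]
      congr 1
      ext ⟨a, b⟩
      have := key_ne_key p (P 0 a) (P 1 b)
      simp
      omega
    · rw [Finset.card_filter, Fintype.sum_prod_type]
      refine Finset.sum_congr rfl fun a _ => ?_
      rw [← Finset.card_filter]
      simp only [(strictMono_key p 2).lt_iff_lt, OrderEmbedding.lt_iff_lt]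
      rw [show (Finset.univ.filter fun b => b < a) = Finset.Iio a by ext; simp, Fin.card_Iio]
  rw [Finset.sum_congr rfl fun i _ => h2 i, Finset.sum_add_distrib, h3, h4] at h1
  rw [← h1]
  ring

end Doubling

section DoublingThick

variable {n r s : ℕ}

lemma two_mul_sum_val_add (s : ℕ) : 2 * ∑ a : Fin s, (a : ℕ) + s = s * s := by
  rw [Fin.sum_univ_eq_sum_range (fun a => a), mul_comm, Finset.sum_range_id_mul_two]
  cases s
  · rfl
  · simp
    ring

lemma sum_emb_sub_val (P : Fin 3 → Fin s ↪o Fin n) :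
    ∑ i, ∑ a, ((P i a : ℕ) - a) + 3 * ∑ a : Fin s, (a : ℕ) = ∑ i, ∑ a, (P i a : ℕ) := by
  have h : ∀ i, ∑ a, ((P i a : ℕ) - a) + ∑ a : Fin s, (a : ℕ) = ∑ a, (P i a : ℕ) := fun i => by
    rw [← Finset.sum_add_distrib]
    exact Finset.sum_congr rfl fun a _ => Nat.sub_add_cancel (le_emb _ _)
  simp only [← h, Finset.sum_add_distrib]
  simp

lemma sum_gaps_le {p : Fin 3 → Fin r ↪o Fin n} (hp : Thick p)
    {P : Fin 3 → Fin s ↪o Fin r} (hP : Thick P) :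
    ∑ i, ∑ a, gaps p i (key p i (P i a)) ≤ s * (2 * n - 2 * r) := by
  refine sum_weight_le_of_thick (key p) (strictMono_key p) (gaps p) (monotone_gaps p)
    (Equiv.swap 0 1) (gaps_swap p) _ (fun s P hP hc => ?_) P hP
  have h1 := sum_gaps p P
  have h2 := sum_le_of_edim_eq_zero p (n - r) (fun t P hP h => hp.sum_le hP h) P hP
  have h3 := hP.edim_nonneg
  rw [edim_eq] at h3
  have h4 := sum_emb_sub_val P
  have h5 := two_mul_sum_val_add s
  have h6 : ∑ i, ∑ a, ((p i (P i a) : ℕ) - P i a) + ∑ i, ∑ a, (P i a : ℕ) =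
      ∑ i, ∑ a, (p i (P i a) : ℕ) := by
    rw [← Finset.sum_add_distrib]
    refine Finset.sum_congr rfl fun i _ => ?_
    rw [← Finset.sum_add_distrib]
    exact Finset.sum_congr rfl fun a _ => Nat.sub_add_cancel (le_emb _ _)
  have h7 : s * (2 * n - 2 * r) = 2 * (s * (n - r)) := by
    rw [← Nat.mul_sub]
    ring
  rw [h7]
  have h3' : ∑ i, ∑ a, ((P i a : ℕ) - a) ≤ s * (r - s) := by
    zify
    linarith
  omega

lemma sum_gaps_eq {p : Fin 3 → Fin r ↪o Fin n} (h0 : edim p = 0) :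
    ∑ i, ∑ a, gaps p i (key p i a) = r * (2 * n - 2 * r) := by
  classical
  have h1 := sum_gaps p fun _ => RelEmbedding.refl (α := Fin r) (· ≤ ·)
  rw [edim_eq] at h0
  have h4 := sum_emb_sub_val p
  have h5 := two_mul_sum_val_add r
  have h7 : r * (2 * n - 2 * r) = 2 * (r * (n - r)) := by
    rw [← Nat.mul_sub]
    ring
  have h0' : ∑ i, ∑ a, ((p i a : ℕ) - a) = r * (n - r) := by
    zify
    linarith
  rw [h7]
  have h2 : ∀ b, b ∈ range (RelEmbedding.refl (α := Fin r) (· ≤ ·)) := fun b => ⟨b, rfl⟩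
  simp only [h2, not_true, false_and, Finset.filter_false, Finset.card_empty,
    Finset.sum_const_zero, RelEmbedding.refl_apply, Finset.sum_const, Finset.card_univ,
    Fintype.card_fin, smul_eq_mul] at h1
  omega

lemma ExtZero.swap {N : ℕ} {V : Type*} [AddCommGroup V] [Module ℝ V] {y : Fin 3 → Fin r → ℕ}
    {v : Fin 3 → Fin r → V} {u : Frames N} (h : ExtZero y v u) (σ : Equiv.Perm (Fin 3)) :
    ExtZero (fun i => y (σ i)) (fun i => v (σ i)) (fun i => u (σ i)) := fun c => by
  obtain ⟨φ, hφ⟩ := h fun i => c (σ.symm i)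
  refine ⟨φ, fun i a b hb => ?_⟩
  have := hφ (σ i) a b hb
  rwa [σ.symm_apply_apply] at this

lemma exists_extZero_swap {N : ℕ} (y : Fin 3 → Fin r → ℕ) (σ : Equiv.Perm (Fin 3))
    (h : ∀ (s : ℕ) (P : Fin 3 → Fin s ↪o Fin r), Thick P → ∑ i, ∑ a, y i (P i a) ≤ s * N) :
    ∃ (v : Frames r) (u : Frames N), Indep v ∧ Indep u ∧ ExtZero y v u ∧
      ExtZero (fun i => y (σ i)) v u := by
  obtain ⟨v, u, -, -, hvu⟩ := exists_extZero y h
  have h1 := (thin_not_extZero hvu).union (thin_not_extZero (hvu.swap σ))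
  have h2 := (thin_not_indep (n := r)).preimage
    (contDiff_fst (E := Frames r) (F := Frames N)) Prod.fst_surjective
  have h3 := (thin_not_indep (n := N)).preimage
    (contDiff_snd (E := Frames r) (F := Frames N)) Prod.snd_surjective
  by_contra! hc
  refine not_thin_of_open isOpen_univ univ_nonempty (fun z _ => ?_) ((h1.union h2).union h3)
  by_contra hz
  simp only [Set.mem_union, Set.mem_preimage, mem_ofPred_eq, not_or, not_not] at hz
  exact hc z.1 z.2 hz.1.2 hz.2 hz.1.1.1 hz.1.1.2

lemma linearIndependent_sumElim {V W ι κ : Type*} [AddCommGroup V] [Module ℝ V] [AddCommGroup W]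
    [Module ℝ W] {v : ι → V} {w : κ → W} (hv : LinearIndependent ℝ v)
    (hw : LinearIndependent ℝ w) :
    LinearIndependent ℝ (Sum.elim (fun a => (v a, (0 : W))) fun b => ((0 : V), w b)) :=
  linearIndependent_inl_union_inr' hv hw

lemma card_gaps_lt {p : Fin 3 → Fin r ↪o Fin n} {i : Fin 3} {q : Fin s ↪o Fin (2 * n)}
    (hq : range q = range (doubled p i)) (c : Fin s) : (q c : ℕ) - c = gaps p i (q c) := by
  classical
  have := card_compl_lt q c
  simp only [hq, Fin.lt_def] at this
  rw [Nat.sub_eq_of_eq_add this.symm, gaps]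

theorem thick_doubled {p : Fin 3 → Fin r ↪o Fin n} (hp : Thick p) (h0 : edim p = 0)
    (q : Fin 3 → Fin (2 * r) ↪o Fin (2 * n)) (hq : ∀ i, range (q i) = range (doubled p i)) :
    Thick q ∧ edim q = 0 := by
  classical
  set y : Fin 3 → Fin r → ℕ := fun i a => gaps p i (key p i a) with hy
  have hg : ∀ i c, ∃ z, doubled p i z = q i c := fun i c => by
    have : q i c ∈ range (doubled p i) := hq i ▸ ⟨c, rfl⟩
    exact this
  choose g hg using hg
  have hginj : ∀ i, Function.Injective (g i) := fun i c d hcd => (q i).injective (by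
    rw [← hg, ← hg, hcd])
  have hgbij : ∀ i, Function.Bijective (g i) := fun i =>
    (Fintype.bijective_iff_injective_and_card _).2 ⟨hginj i, by simp; ring⟩
  have hqc : ∀ i c, (q i c : ℕ) - c = Sum.elim (y i) (y (Equiv.swap 0 1 i)) (g i c) :=
    fun i c => by
    rw [card_gaps_lt (hq i), ← hg]
    rcases g i c with a | a
    · rfl
    · exact gaps_doubled_inr p i a
  constructor
  · obtain ⟨v, u, hv, hu, h1, h2⟩ := exists_extZero_swap (N := 2 * n - 2 * r) y (Equiv.swap 0 1)
      fun s P hP => sum_gaps_le hp hP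
    let e : ((Fin r → ℝ) × (Fin r → ℝ)) ≃ₗ[ℝ] (Fin (2 * r) → ℝ) :=
      LinearEquiv.ofFinrankEq _ _ (by simp; ring)
    have hr := emb_le (p 0)
    refine thick_of_extZero (N := 2 * n - 2 * r) q (by omega) (x := fun i c =>
      e (Sum.elim (fun a => (v i a, 0)) (fun a => (0, v i a)) (g i c))) (fun i => ?_) hu
      fun c => ?_
    · exact ((linearIndependent_sumElim (hv i) (hv i)).comp _ (hginj i)).map' e.toLinearMap e.ker
    · obtain ⟨ψ, hψ⟩ : ∃ ψ : ∀ i, Fin r ⊕ Fin r → Fin (2 * n - 2 * r) → ℝ,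
          ∀ i d, ψ i (g i d) = c i d :=
        ⟨fun i z => c i ((Equiv.ofBijective _ (hgbij i)).symm z), fun i d =>
          congrArg (c i) (Equiv.ofBijective_symm_apply_apply (g i) (hgbij i) d)⟩
      obtain ⟨φ₁, hφ₁⟩ := h1 fun i a => ψ i (.inl a)
      obtain ⟨φ₂, hφ₂⟩ := h2 fun i a => ψ i (.inr a)
      refine ⟨(φ₁.coprod φ₂) ∘ₗ e.symm.toLinearMap, fun i d b hb => ?_⟩
      replace hb := (hqc i d).subst hb
      beta_reduce
      rw [← hψ, LinearMap.comp_apply, LinearEquiv.coe_coe, LinearEquiv.symm_apply_apply]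
      generalize g i d = z at hb ⊢
      rcases z with a | a
      · simpa using hφ₁ i a b hb
      · simpa using hφ₂ i a b hb
  · have h1 : ∑ i, ∑ c, ((q i c : ℕ) - c) = 2 * (r * (2 * n - 2 * r)) := by
      have h2 : ∑ i, ∑ a, y i a = r * (2 * n - 2 * r) := sum_gaps_eq h0
      have h3 := h2
      rw [← Equiv.sum_comp (Equiv.swap (0 : Fin 3) 1)] at h3
      refine Eq.trans ?_ ((congrArg₂ HAdd.hAdd h2 h3).trans (two_mul _).symm)
      rw [← Finset.sum_add_distrib]
      refine Finset.sum_congr rfl fun i _ => ?_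
      rw [Finset.sum_congr rfl fun c _ => hqc i c,
        (hgbij i).sum_comp (Sum.elim (y i) (y (Equiv.swap 0 1 i))), Fintype.sum_sum_type]
      rfl
    rw [edim_eq, sub_eq_zero]
    zify at h1
    rw [h1]
    push_cast
    ring

end DoublingThick

section DoublingSets

variable {n r : ℕ}

lemma exists_emb_range_eq (p : Fin 3 → Fin r ↪o Fin n) (i : Fin 3) :
    ∃ q : Fin (2 * r) ↪o Fin (2 * n), range q = range (doubled p i) := by
  classical
  have h : (Finset.univ.image (doubled p i)).card = 2 * r := by
    rw [Finset.card_image_of_injective _ (doubled_injective p i)]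
    simp
    ring
  refine ⟨Finset.orderEmbOfFin _ h, ?_⟩
  rw [Finset.range_orderEmbOfFin]
  simp

lemma image_eq_image {m k l : ℕ} {f : Fin k → Fin m} {g : Fin l ⊕ Fin l → Fin m}
    (h : range f = range g) (F : Fin m → ℕ) :
    Finset.univ.image (fun a => F (f a)) = Finset.univ.image fun z => F (g z) := by
  apply Finset.coe_injective
  simp only [Finset.coe_image, Finset.coe_univ, image_univ]
  exact (range_comp F f).trans ((congrArg (F '' ·) h).trans (range_comp F g).symm)

lemma up_eq_image {p : Fin 3 → Fin r ↪o Fin n} {i : Fin 3} {q : Fin (2 * r) ↪o Fin (2 * n)}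
    (hq : range q = range (doubled p i)) :
    up q = Finset.univ.image fun z => (doubled p i z : ℕ) + 1 :=
  image_eq_image hq fun b => (b : ℕ) + 1

lemma down_eq_image {p : Fin 3 → Fin r ↪o Fin n} {i : Fin 3} {q : Fin (2 * r) ↪o Fin (2 * n)}
    (hq : range q = range (doubled p i)) :
    down q = Finset.univ.image fun z => 2 * n - (doubled p i z : ℕ) :=
  image_eq_image hq fun b => 2 * n - (b : ℕ)

lemma image_doubled_zero (p : Fin 3 → Fin r ↪o Fin n) :
    Finset.univ.image (fun z => (doubled p 0 z : ℕ) + 1) =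
      (up (p 0)).image (fun i => 2 * i - 1) ∪ (up (p 1)).image fun j => 2 * j := by
  ext m
  simp [up, doubled, Nat.mul_add]

lemma image_doubled_two (p : Fin 3 → Fin r ↪o Fin n) :
    Finset.univ.image (fun z => 2 * n - (doubled p 2 z : ℕ)) =
      (down (p 2)).image (fun k => 2 * k - 1) ∪ (down (p 2)).image fun k => 2 * k := by
  ext m
  simp [down, doubled, Nat.mul_sub, ← Nat.sub_sub]
  exact or_comm

lemma isT_doubled {n r : ℕ} {I J K : Finset ℕ} (hT : IsT n r I J K) :
    IsT (2 * n) (2 * r)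
      (I.image (fun i => 2 * i - 1) ∪ J.image (fun j => 2 * j))
      (I.image (fun i => 2 * i - 1) ∪ J.image (fun j => 2 * j))
      (K.image (fun k => 2 * k - 1) ∪ K.image (fun k => 2 * k)) := by
  have hU := hT
  rw [IsT] at hU
  obtain ⟨t, rfl, rfl, rfl⟩ := exists_eq_of_isU hU.1
  obtain ⟨h1, h2⟩ := (isT_iff t).1 hT
  choose q hq using exists_emb_range_eq t
  have h := (isT_iff q).2 (thick_doubled h1 h2 q hq)
  rwa [up_eq_image (hq 0), up_eq_image ((hq 1).trans (range_doubled_swap t 0)),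
    down_eq_image (hq 2), image_doubled_zero, image_doubled_two] at h

end DoublingSets

end HornDoubling

/-- Lemma 1.18 of Fomin–Fulton–Li–Poon. If `(I, J, K) ∈ T^p_r`,
then the doubled triple `(I₂, J₂, K₂)`, where
`I₂ = J₂ = {2i-1 : i ∈ I} ∪ {2j : j ∈ J}` and `K₂ = {2k-1 : k ∈ K} ∪ {2k : k ∈ K}`,
belongs to `T^{2p}_{2r}`. -/
theorem doubled_triple_mem_T
    (p r : ℕ) (hp : 1 ≤ p) (hr : 1 ≤ r) (hrp : r < p)
    (I J K : Finset ℕ) (hT : IsT p r I J K) :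
    IsT (2 * p) (2 * r)
      (I.image (fun i => 2 * i - 1) ∪ J.image (fun j => 2 * j))
      (I.image (fun i => 2 * i - 1) ∪ J.image (fun j => 2 * j))
      (K.image (fun k => 2 * k - 1) ∪ K.image (fun k => 2 * k)) := by
  exact HornDoubling.isT_doubled hT
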